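/- arXiv:math/0305410 — 3 statements merged into one kernel-verified Lean document; each statement's English description precedes it below -/
import Mathlib

section
/- For every fixed 1 ≤ q < ∞, lim_{n→∞} n · (E V_{B_qⁿ}²)^{1/n} = α(1/q) and lim_{n→∞} n² · (E V_{B_qⁿ}⁴)^{1/n} = α(1/q)², where α(t) = e^{1 − 2t} Γ(1 + 3t) / (3 Γ(1 + t)³). -/
open MeasureTheory Pointwise Filter

/-- The unit ball of `ℓ_qⁿ`: `B_qⁿ = { x ∈ ℝⁿ : Σ |x_i|^q ≤ 1 }`. -/
noncomputable def lqBall (n : ℕ) (q : ℝ) : Set (EuclideanSpace ℝ (Fin n)) :=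
  {x | ∑ i, |x i| ^ q ≤ 1}

/-- The uniform probability measure on a set `K` in `ℝⁿ`. -/
noncomputable def unifMeasure (n : ℕ) (K : Set (EuclideanSpace ℝ (Fin n))) :
    Measure (EuclideanSpace ℝ (Fin n)) :=
  (volume K)⁻¹ • volume.restrict K

/-- The joint distribution of `N` independent uniform random points in `K`. -/
noncomputable def jointUnif (n N : ℕ) (K : Set (EuclideanSpace ℝ (Fin n))) :
    Measure (Fin N → EuclideanSpace ℝ (Fin n)) :=
  Measure.pi fun _ => unifMeasure n K

/-- `V_K`: the normalized volume of the symmetric convex hull of `n` points. -/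
noncomputable def randCrossVol (n : ℕ) (K : Set (EuclideanSpace ℝ (Fin n)))
    (x : Fin n → EuclideanSpace ℝ (Fin n)) : ℝ :=
  (volume (convexHull ℝ (Set.range x ∪ -Set.range x))).toReal / (volume K).toReal

/-- `𝔼 V_{B_qⁿ}^p`, the `p`-th moment of the normalized volume of a random
crosspolytope in `B_qⁿ`. -/
noncomputable def momentVlq (n : ℕ) (q : ℝ) (p : ℕ) : ℝ :=
  ∫ x, randCrossVol n (lqBall n q) x ^ p ∂(jointUnif n n (lqBall n q))

/-- The function `α(t) = e^{1−2t} Γ(1+3t) / (3 Γ(1+t)³)`. -/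
noncomputable def alphaFn (t : ℝ) : ℝ :=
  Real.exp (1 - 2 * t) * Real.Gamma (1 + 3 * t) / (3 * Real.Gamma (1 + t) ^ 3)

open Real in
lemma log_Gamma_sub_bounds {x s : ℝ} (hx : 0 < x) (hs : 0 < s) :
    s * log x ≤ log (Gamma (1 + x + s)) - log (Gamma (1 + x)) ∧
      log (Gamma (1 + x + s)) - log (Gamma (1 + x)) ≤ s * log (1 + x + s) := by
  have hc := convexOn_log_Gamma
  have hstep : ∀ y : ℝ, 0 < y → log (Gamma (y + 1)) - log (Gamma y) = log y := by
    intro y hy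
    rw [Gamma_add_one hy.ne', log_mul hy.ne' (Gamma_pos_of_pos hy).ne']
    ring
  have h1 := hc.slope_mono_adjacent (x := x) (y := 1 + x) (z := 1 + x + s)
    (Set.mem_Ioi.2 hx) (Set.mem_Ioi.2 (by linarith)) (by linarith) (by linarith)
  have h2 := hc.slope_mono_adjacent (x := 1 + x) (y := 1 + x + s) (z := 1 + x + s + 1)
    (Set.mem_Ioi.2 (by linarith)) (Set.mem_Ioi.2 (by linarith)) (by linarith) (by linarith)
  have e1 := hstep x hx
  have e2 := hstep (1 + x + s) (by linarith)
  rw [add_comm x 1] at e1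
  simp only [Function.comp_apply, add_sub_cancel_left, add_sub_cancel_right, div_one] at h1 h2
  rw [e1, le_div_iff₀ hs] at h1
  rw [e2, div_le_iff₀ hs] at h2
  constructor <;> nlinarith

open Real in
lemma tendsto_log_Gamma_add_sub {s : ℝ} (hs : 0 < s) :
    Tendsto (fun x : ℝ => log (Gamma (1 + x + s)) - log (Gamma (1 + x)) - s * log x)
      atTop (nhds 0) := by
  have hu : Tendsto (fun x : ℝ => s * log ((1 + s) / x + 1)) atTop (nhds 0) := by
    have h : Tendsto (fun x : ℝ => (1 + s) / x + 1) atTop (nhds (0 + 1)) :=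
      (tendsto_const_nhds.div_atTop tendsto_id).add_const 1
    rw [zero_add] at h
    simpa using ((continuousAt_log one_ne_zero).tendsto.comp h).const_mul s
  refine tendsto_of_tendsto_of_tendsto_of_le_of_le' tendsto_const_nhds hu ?_ ?_
  · filter_upwards [eventually_gt_atTop 0] with x hx
    linarith [(log_Gamma_sub_bounds hx hs).1]
  · filter_upwards [eventually_gt_atTop 0] with x hx
    have h := (log_Gamma_sub_bounds hx hs).2
    have e : (1 + s) / x + 1 = (1 + x + s) / x := by field_simp; ring
    rw [e, log_div (by positivity) hx.ne']
    linarith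

open Real in
lemma tendsto_succ_mul_log_sub :
    Tendsto (fun n : ℕ => ((n : ℝ) + 1) * (log (n + 1) - log n)) atTop (nhds 1) := by
  have hu : Tendsto (fun n : ℕ => 1 + 1 / (n : ℝ)) atTop (nhds 1) := by
    simpa using tendsto_const_nhds.add (tendsto_one_div_atTop_nhds_zero_nat (𝕜 := ℝ))
  refine tendsto_of_tendsto_of_tendsto_of_le_of_le' tendsto_const_nhds hu ?_ ?_
  · filter_upwards [eventually_gt_atTop 0] with n hn
    have hn : (0 : ℝ) < n := by exact_mod_cast hn
    have h := one_sub_inv_le_log_of_pos (x := ((n : ℝ) + 1) / n) (by positivity)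
    rw [log_div (by positivity) hn.ne', inv_div] at h
    have e : 1 - (n : ℝ) / (n + 1) = 1 / (n + 1) := by field_simp; ring
    rw [e, div_le_iff₀ (by positivity)] at h
    linarith
  · filter_upwards [eventually_gt_atTop 0] with n hn
    have hn : (0 : ℝ) < n := by exact_mod_cast hn
    have h := log_le_sub_one_of_pos (x := ((n : ℝ) + 1) / n) (by positivity)
    rw [log_div (by positivity) hn.ne'] at h
    have e : ((n : ℝ) + 1) / n - 1 = 1 / n := by field_simp; ring
    rw [e] at h
    calc ((n : ℝ) + 1) * (log (n + 1) - log n) ≤ (n + 1) * (1 / n) := by gcongr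
      _ = 1 + 1 / n := by field_simp

open Real in
lemma tendsto_log_Gamma_div {t : ℝ} (ht : 0 < t) :
    Tendsto (fun n : ℕ => log (Gamma (1 + n * t)) / n - t * log (n * t)) atTop (nhds (-t)) := by
  set a : ℕ → ℝ := fun n => log (Gamma (1 + n * t)) - t * (n * log (n * t)) with ha
  have hnt : Tendsto (fun n : ℕ => (n : ℝ) * t) atTop atTop :=
    tendsto_natCast_atTop_atTop.atTop_mul_const ht
  have hd : Tendsto (fun n => a (n + 1) - a n) atTop (nhds (-t)) := by
    have h := ((tendsto_log_Gamma_add_sub ht).comp hnt).sub (tendsto_succ_mul_log_sub.const_mul t)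
    rw [zero_sub, mul_one] at h
    refine h.congr' ?_
    filter_upwards [eventually_gt_atTop 0] with n hn
    have hn : (0 : ℝ) < n := by exact_mod_cast hn
    simp only [ha, Function.comp_apply, Nat.cast_add, Nat.cast_one]
    rw [log_mul hn.ne' ht.ne', log_mul (by positivity : (n : ℝ) + 1 ≠ 0) ht.ne']
    rw [show 1 + ((n : ℝ) + 1) * t = 1 + n * t + t by ring]
    ring
  have hc := hd.cesaro
  refine hc.congr' ?_
  filter_upwards [eventually_gt_atTop 0] with n hn
  have hn : (0 : ℝ) < n := by exact_mod_cast hn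
  rw [Finset.sum_range_sub]
  simp only [ha, Nat.cast_zero, zero_mul, add_zero, Gamma_one, log_one, mul_zero, sub_zero]
  field_simp

/-- The projection onto the orthogonal complement of the rows of `X`
(when the rows are linearly independent). -/
noncomputable def complProj {k n : ℕ} (X : Matrix (Fin k) (Fin n) ℝ) :
    Matrix (Fin n) (Fin n) ℝ :=
  1 - X.transpose * (X * X.transpose)⁻¹ * X

open Matrix in
lemma complProj_transpose {k n : ℕ} (X : Matrix (Fin k) (Fin n) ℝ) :
    (complProj X)ᵀ = complProj X := by
  simp [complProj, Matrix.transpose_sub, Matrix.transpose_mul, Matrix.transpose_nonsing_inv,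
    Matrix.mul_assoc]

open Matrix in
lemma complProj_mul_self {k n : ℕ} {X : Matrix (Fin k) (Fin n) ℝ} (h : (X * Xᵀ).det ≠ 0) :
    complProj X * complProj X = complProj X := by
  have h' : IsUnit (X * Xᵀ).det := h.isUnit
  have e : Xᵀ * (X * Xᵀ)⁻¹ * X * (Xᵀ * (X * Xᵀ)⁻¹ * X) = Xᵀ * (X * Xᵀ)⁻¹ * X := by
    calc _ = Xᵀ * ((X * Xᵀ)⁻¹ * (X * Xᵀ)) * (X * Xᵀ)⁻¹ * X := by simp only [Matrix.mul_assoc]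
      _ = _ := by rw [Matrix.nonsing_inv_mul _ h', Matrix.mul_one]
  rw [complProj, sub_mul, mul_sub, mul_sub, e]
  simp

open Matrix in
lemma trace_complProj {k n : ℕ} {X : Matrix (Fin k) (Fin n) ℝ} (h : (X * Xᵀ).det ≠ 0) :
    (complProj X).trace = n - k := by
  have h' : IsUnit (X * Xᵀ).det := h.isUnit
  rw [complProj, Matrix.trace_sub, Matrix.trace_mul_comm, ← Matrix.mul_assoc,
    Matrix.mul_nonsing_inv _ h']
  simp

open Matrix in
lemma det_mul_transpose_cons {k n : ℕ} (y : Fin n → ℝ) (x : Fin k → Fin n → ℝ) :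
    (Matrix.of (Fin.cons y x : Fin (k + 1) → Fin n → ℝ) *
        (Matrix.of (Fin.cons y x : Fin (k + 1) → Fin n → ℝ))ᵀ).det =
      (Matrix.of x * (Matrix.of x)ᵀ).det * (y ⬝ᵥ complProj (Matrix.of x) *ᵥ y) := by
  set X := Matrix.of x with hX
  set X' := Matrix.of (Fin.cons y x : Fin (k + 1) → Fin n → ℝ) with hX'
  by_cases h : (X * Xᵀ).det = 0
  · rw [h, zero_mul]
    obtain ⟨v, hv0, hv⟩ := Matrix.exists_vecMul_eq_zero_iff.2 h
    have hv' : v ᵥ* X = 0 := by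
      rw [← dotProduct_self_eq_zero]
      calc (v ᵥ* X) ⬝ᵥ (v ᵥ* X) = (v ᵥ* (X * Xᵀ)) ⬝ᵥ v := by
            rw [← Matrix.vecMul_vecMul, Matrix.vecMul_transpose, ← Matrix.dotProduct_mulVec,
              dotProduct_comm]
        _ = 0 := by rw [hv, zero_dotProduct]
    refine Matrix.exists_vecMul_eq_zero_iff.1 ⟨(Fin.cons 0 v : Fin (k + 1) → ℝ), ?_, ?_⟩
    · intro hc
      apply hv0
      funext i
      simpa using congrFun hc i.succ
    · rw [← Matrix.vecMul_vecMul]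
      have : (Fin.cons 0 v : Fin (k + 1) → ℝ) ᵥ* X' = 0 := by
        funext j
        have := congrFun hv' j
        simpa [Matrix.vecMul, dotProduct, Fin.sum_univ_succ, hX', hX] using this
      rw [this, Matrix.zero_vecMul]
  · let e : Unit ⊕ Fin k ≃ Fin (k + 1) :=
      ((Equiv.sumComm _ _).trans (Equiv.optionEquivSumPUnit (Fin k)).symm).trans
        (finSuccEquiv k).symm
    have e0 : ∀ u, e (Sum.inl u) = 0 := by intro u; simp [e]
    have e1 : ∀ i, e (Sum.inr i) = i.succ := by intro i; simp [e]
    let : Invertible (X * Xᵀ) := Matrix.invertibleOfIsUnitDet _ (Ne.isUnit h)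
    let Y : Matrix Unit (Fin n) ℝ := Matrix.of fun _ => y
    have hb : (X' * X'ᵀ).submatrix e e = Matrix.fromBlocks (Y * Yᵀ) (Y * Xᵀ) (X * Yᵀ) (X * Xᵀ) := by
      ext i j
      rcases i with i | i <;> rcases j with j | j <;>
        simp [e0, e1, Matrix.mul_apply, hX', Y, hX]
    rw [← Matrix.det_submatrix_equiv_self e, hb, Matrix.det_fromBlocks₂₂, Matrix.det_unique (n := Unit)]
    congr 1
    have : Y * Yᵀ - Y * Xᵀ * ⅟(X * Xᵀ) * (X * Yᵀ) = Y * complProj X * Yᵀ := by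
      rw [complProj, Matrix.mul_sub, Matrix.sub_mul, Matrix.invOf_eq_nonsing_inv]
      simp only [Matrix.mul_assoc, Matrix.mul_one]
    rw [this, Matrix.mul_assoc]
    simp [Matrix.mul_apply, dotProduct, Matrix.mulVec, Y]

section ProductMoments

variable {μ : Measure ℝ} [IsProbabilityMeasure μ]

open Matrix in
lemma piFinSuccAbove_symm_dotProduct {n : ℕ} (u : Fin (n + 1) → ℝ) (p : ℝ × (Fin n → ℝ)) :
    u ⬝ᵥ (MeasurableEquiv.piFinSuccAbove (fun _ : Fin (n + 1) => ℝ) 0).symm p =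
      u 0 * p.1 + (fun i : Fin n => u i.succ) ⬝ᵥ p.2 := by
  simp [dotProduct, Fin.sum_univ_succ, MeasurableEquiv.piFinSuccAbove]

open Matrix in
lemma integrable_dotProduct_pow (hpow : ∀ k : ℕ, Integrable (fun x : ℝ => x ^ k) μ)
    {n : ℕ} (u : Fin n → ℝ) (k : ℕ) :
    Integrable (fun y : Fin n → ℝ => (u ⬝ᵥ y) ^ k) (Measure.pi fun _ => μ) := by
  induction n generalizing k with
  | zero => simp [dotProduct]
  | succ n ih =>
    have mp := (measurePreserving_piFinSuccAbove (fun _ : Fin (n + 1) => μ) 0).symm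
    rw [← mp.integrable_comp_emb (MeasurableEquiv.measurableEmbedding _)]
    simp only [Function.comp_def, piFinSuccAbove_symm_dotProduct, add_pow]
    refine integrable_finsetSum _ fun m _ => ?_
    refine Integrable.mul_const ?_ _
    simp only [mul_pow]
    exact ((hpow m).const_mul (u 0 ^ m)).mul_prod (ih (fun i => u i.succ) (k - m))

open Matrix in
lemma integral_dotProduct_sq (hpow : ∀ k : ℕ, Integrable (fun x : ℝ => x ^ k) μ)
    (h1 : ∫ x, x ∂μ = 0) {n : ℕ} (u : Fin n → ℝ) :
    ∫ y, (u ⬝ᵥ y) ^ 2 ∂(Measure.pi fun _ => μ) = (∫ x, x ^ 2 ∂μ) * ∑ i, u i ^ 2 := by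
  induction n with
  | zero => simp [dotProduct]
  | succ n ih =>
    have mp := (measurePreserving_piFinSuccAbove (fun _ : Fin (n + 1) => μ) 0).symm
    rw [← mp.integral_comp (MeasurableEquiv.measurableEmbedding _)]
    simp only [piFinSuccAbove_symm_dotProduct]
    set w : Fin n → ℝ := fun i => u i.succ with hw
    have I (a b : ℕ) : Integrable (fun p : ℝ × (Fin n → ℝ) => p.1 ^ a * (w ⬝ᵥ p.2) ^ b)
        (μ.prod (Measure.pi fun _ => μ)) :=
      (hpow a).mul_prod (integrable_dotProduct_pow hpow w b)
    have V (a b : ℕ) : ∫ p : ℝ × (Fin n → ℝ), p.1 ^ a * (w ⬝ᵥ p.2) ^ b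
          ∂(μ.prod (Measure.pi fun _ => μ)) =
        (∫ x, x ^ a ∂μ) * ∫ y, (w ⬝ᵥ y) ^ b ∂(Measure.pi fun _ => μ) :=
      integral_prod_mul (fun x : ℝ => x ^ a) (fun y : Fin n → ℝ => (w ⬝ᵥ y) ^ b)
    have e : ∀ p : ℝ × (Fin n → ℝ), (u 0 * p.1 + w ⬝ᵥ p.2) ^ 2 =
        u 0 ^ 2 * (p.1 ^ 2 * (w ⬝ᵥ p.2) ^ 0) + 2 * u 0 * (p.1 ^ 1 * (w ⬝ᵥ p.2) ^ 1) +
          p.1 ^ 0 * (w ⬝ᵥ p.2) ^ 2 := fun p => by ring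
    simp only [e]
    rw [integral_add (((I 2 0).const_mul _).fun_add ((I 1 1).const_mul _)) (I 0 2),
      integral_add ((I 2 0).const_mul _) ((I 1 1).const_mul _),
      integral_const_mul, integral_const_mul, V, V, V, ih]
    simp [h1, Fin.sum_univ_succ, hw]
    ring

open Matrix in
lemma integral_dotProduct_pow_four (hpow : ∀ k : ℕ, Integrable (fun x : ℝ => x ^ k) μ)
    (h1 : ∫ x, x ∂μ = 0) (h3 : ∫ x, x ^ 3 ∂μ = 0) {n : ℕ} (u : Fin n → ℝ) :
    ∫ y, (u ⬝ᵥ y) ^ 4 ∂(Measure.pi fun _ => μ) =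
      3 * (∫ x, x ^ 2 ∂μ) ^ 2 * (∑ i, u i ^ 2) ^ 2 +
        ((∫ x, x ^ 4 ∂μ) - 3 * (∫ x, x ^ 2 ∂μ) ^ 2) * ∑ i, u i ^ 4 := by
  induction n with
  | zero => simp [dotProduct]
  | succ n ih =>
    have mp := (measurePreserving_piFinSuccAbove (fun _ : Fin (n + 1) => μ) 0).symm
    rw [← mp.integral_comp (MeasurableEquiv.measurableEmbedding _)]
    simp only [piFinSuccAbove_symm_dotProduct]
    set w : Fin n → ℝ := fun i => u i.succ with hw
    have I (a b : ℕ) : Integrable (fun p : ℝ × (Fin n → ℝ) => p.1 ^ a * (w ⬝ᵥ p.2) ^ b)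
        (μ.prod (Measure.pi fun _ => μ)) :=
      (hpow a).mul_prod (integrable_dotProduct_pow hpow w b)
    have V (a b : ℕ) : ∫ p : ℝ × (Fin n → ℝ), p.1 ^ a * (w ⬝ᵥ p.2) ^ b
          ∂(μ.prod (Measure.pi fun _ => μ)) =
        (∫ x, x ^ a ∂μ) * ∫ y, (w ⬝ᵥ y) ^ b ∂(Measure.pi fun _ => μ) :=
      integral_prod_mul (fun x : ℝ => x ^ a) (fun y : Fin n → ℝ => (w ⬝ᵥ y) ^ b)
    have e : ∀ p : ℝ × (Fin n → ℝ), (u 0 * p.1 + w ⬝ᵥ p.2) ^ 4 =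
        u 0 ^ 4 * (p.1 ^ 4 * (w ⬝ᵥ p.2) ^ 0) + 4 * u 0 ^ 3 * (p.1 ^ 3 * (w ⬝ᵥ p.2) ^ 1) +
          6 * u 0 ^ 2 * (p.1 ^ 2 * (w ⬝ᵥ p.2) ^ 2) + 4 * u 0 * (p.1 ^ 1 * (w ⬝ᵥ p.2) ^ 3) +
          p.1 ^ 0 * (w ⬝ᵥ p.2) ^ 4 := fun p => by ring
    have J4 := (I 4 0).const_mul (u 0 ^ 4)
    have J3 := (I 3 1).const_mul (4 * u 0 ^ 3)
    have J2 := (I 2 2).const_mul (6 * u 0 ^ 2)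
    have J1 := (I 1 3).const_mul (4 * u 0)
    simp only [e]
    rw [integral_add (((J4.fun_add J3).fun_add J2).fun_add J1) (I 0 4),
      integral_add ((J4.fun_add J3).fun_add J2) J1, integral_add (J4.fun_add J3) J2, integral_add J4 J3,
      integral_const_mul, integral_const_mul, integral_const_mul, integral_const_mul,
      V, V, V, V, V, ih, integral_dotProduct_sq hpow h1]
    simp [h1, h3, Fin.sum_univ_succ, hw]
    ring

open Matrix in
lemma dotProduct_sq_mul_sq_eq {n : ℕ} (u w y : Fin n → ℝ) :
    (u ⬝ᵥ y) ^ 2 * (w ⬝ᵥ y) ^ 2 =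
      (1 / 12) * ((u + w) ⬝ᵥ y) ^ 4 + (1 / 12) * ((u - w) ⬝ᵥ y) ^ 4 +
        (-1 / 6) * (u ⬝ᵥ y) ^ 4 + (-1 / 6) * (w ⬝ᵥ y) ^ 4 := by
  rw [add_dotProduct, sub_dotProduct]
  ring

open Matrix in
lemma integrable_dotProduct_sq_mul_sq (hpow : ∀ k : ℕ, Integrable (fun x : ℝ => x ^ k) μ)
    {n : ℕ} (u w : Fin n → ℝ) :
    Integrable (fun y : Fin n → ℝ => (u ⬝ᵥ y) ^ 2 * (w ⬝ᵥ y) ^ 2) (Measure.pi fun _ => μ) := by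
  simp only [dotProduct_sq_mul_sq_eq]
  have I := fun a : Fin n → ℝ => integrable_dotProduct_pow hpow a 4
  exact ((((I _).const_mul _).add ((I _).const_mul _)).add ((I _).const_mul _)).add
    ((I _).const_mul _)

open Matrix in
lemma integral_dotProduct_sq_mul_sq (hpow : ∀ k : ℕ, Integrable (fun x : ℝ => x ^ k) μ)
    (h1 : ∫ x, x ∂μ = 0) (h3 : ∫ x, x ^ 3 ∂μ = 0) {n : ℕ} (u w : Fin n → ℝ) :
    ∫ y, (u ⬝ᵥ y) ^ 2 * (w ⬝ᵥ y) ^ 2 ∂(Measure.pi fun _ => μ) =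
      (∫ x, x ^ 2 ∂μ) ^ 2 * ((∑ i, u i ^ 2) * (∑ i, w i ^ 2) + 2 * (∑ i, u i * w i) ^ 2) +
        ((∫ x, x ^ 4 ∂μ) - 3 * (∫ x, x ^ 2 ∂μ) ^ 2) * ∑ i, u i ^ 2 * w i ^ 2 := by
  simp only [dotProduct_sq_mul_sq_eq]
  have I := fun (c : ℝ) (a : Fin n → ℝ) => (integrable_dotProduct_pow hpow a 4).const_mul c
  rw [integral_add (((I _ _).fun_add (I _ _)).fun_add (I _ _)) (I _ _),
    integral_add ((I _ _).fun_add (I _ _)) (I _ _), integral_add (I _ _) (I _ _)]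
  simp only [integral_const_mul, integral_dotProduct_pow_four hpow h1 h3]
  have e1 : ∑ i, (u + w) i ^ 2 = ∑ i, u i ^ 2 + 2 * ∑ i, u i * w i + ∑ i, w i ^ 2 := by
    rw [Finset.mul_sum, ← Finset.sum_add_distrib, ← Finset.sum_add_distrib]
    exact Finset.sum_congr rfl fun i _ => by simp only [Pi.add_apply]; ring
  have e2 : ∑ i, (u - w) i ^ 2 = ∑ i, u i ^ 2 - 2 * ∑ i, u i * w i + ∑ i, w i ^ 2 := by
    rw [Finset.mul_sum, ← Finset.sum_sub_distrib, ← Finset.sum_add_distrib]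
    exact Finset.sum_congr rfl fun i _ => by simp only [Pi.sub_apply]; ring
  have e3 : ∑ i, (u + w) i ^ 4 + ∑ i, (u - w) i ^ 4 =
      2 * ∑ i, u i ^ 4 + 12 * ∑ i, u i ^ 2 * w i ^ 2 + 2 * ∑ i, w i ^ 4 := by
    simp only [Finset.mul_sum, ← Finset.sum_add_distrib]
    exact Finset.sum_congr rfl fun i _ => by simp only [Pi.add_apply, Pi.sub_apply]; ring
  rw [e1, e2]
  linear_combination
    ((∫ x, x ^ 4 ∂μ) - 3 * (∫ x, x ^ 2 ∂μ) ^ 2) / 12 * e3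

open Matrix in
lemma dotProduct_mulVec_proj {n : ℕ} {P : Matrix (Fin n) (Fin n) ℝ} (hT : Pᵀ = P)
    (hP : P * P = P) (y : Fin n → ℝ) : y ⬝ᵥ P *ᵥ y = ∑ a, (P a ⬝ᵥ y) ^ 2 := by
  calc y ⬝ᵥ P *ᵥ y = (P *ᵥ y) ⬝ᵥ (P *ᵥ y) := by
        rw [Matrix.dotProduct_mulVec (P *ᵥ y), Matrix.vecMul_mulVec, hT, hP,
          ← Matrix.mulVec_transpose, hT, dotProduct_comm]
    _ = ∑ a, (P a ⬝ᵥ y) ^ 2 := Finset.sum_congr rfl fun a _ => by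
        simp only [Matrix.mulVec, sq]

open Matrix in
lemma sum_mul_proj {n : ℕ} {P : Matrix (Fin n) (Fin n) ℝ} (hT : Pᵀ = P)
    (hP : P * P = P) (a b : Fin n) : ∑ i, P a i * P b i = P a b := by
  conv_rhs => rw [← hP, Matrix.mul_apply]
  exact Finset.sum_congr rfl fun i _ => by rw [← congrFun (congrFun hT b) i, Matrix.transpose_apply]

open Matrix in
lemma integrable_proj (hpow : ∀ k : ℕ, Integrable (fun x : ℝ => x ^ k) μ)
    {n : ℕ} {P : Matrix (Fin n) (Fin n) ℝ} (hT : Pᵀ = P) (hP : P * P = P) :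
    Integrable (fun y => y ⬝ᵥ P *ᵥ y) (Measure.pi fun _ => μ) := by
  simp only [dotProduct_mulVec_proj hT hP]
  exact integrable_finsetSum _ fun a _ => integrable_dotProduct_pow hpow (P a) 2

open Matrix in
lemma integrable_proj_sq (hpow : ∀ k : ℕ, Integrable (fun x : ℝ => x ^ k) μ)
    {n : ℕ} {P : Matrix (Fin n) (Fin n) ℝ} (hT : Pᵀ = P) (hP : P * P = P) :
    Integrable (fun y => (y ⬝ᵥ P *ᵥ y) ^ 2) (Measure.pi fun _ => μ) := by
  simp only [dotProduct_mulVec_proj hT hP, sq (∑ a, _), Finset.sum_mul_sum]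
  exact integrable_finsetSum _ fun a _ => integrable_finsetSum _ fun b _ =>
    integrable_dotProduct_sq_mul_sq hpow (P a) (P b)

open Matrix in
lemma integral_proj (hpow : ∀ k : ℕ, Integrable (fun x : ℝ => x ^ k) μ)
    (h1 : ∫ x, x ∂μ = 0) {n : ℕ} {P : Matrix (Fin n) (Fin n) ℝ} (hT : Pᵀ = P) (hP : P * P = P) :
    ∫ y, y ⬝ᵥ P *ᵥ y ∂(Measure.pi fun _ => μ) = (∫ x, x ^ 2 ∂μ) * P.trace := by
  simp only [dotProduct_mulVec_proj hT hP]
  rw [integral_finsetSum _ fun a _ => integrable_dotProduct_pow hpow (P a) 2]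
  rw [Matrix.trace, Finset.mul_sum]
  refine Finset.sum_congr rfl fun a _ => ?_
  rw [integral_dotProduct_sq hpow h1, Matrix.diag_apply, ← sum_mul_proj hT hP a a]
  simp only [sq]

open Matrix in
/-- The second moment of the quadratic form of a projection. -/
lemma integral_proj_sq_le (hpow : ∀ k : ℕ, Integrable (fun x : ℝ => x ^ k) μ)
    (h1 : ∫ x, x ∂μ = 0) (h3 : ∫ x, x ^ 3 ∂μ = 0) {n : ℕ} {P : Matrix (Fin n) (Fin n) ℝ}
    (hT : Pᵀ = P) (hP : P * P = P) :
    ∫ y, (y ⬝ᵥ P *ᵥ y) ^ 2 ∂(Measure.pi fun _ => μ) ≤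
      (∫ x, x ^ 2 ∂μ) ^ 2 * (P.trace ^ 2 + 2 * P.trace) + (∫ x, x ^ 4 ∂μ) * P.trace := by
  have hs := sum_mul_proj hT hP
  have hdiag : ∀ i, P i i ^ 2 ≤ P i i := fun i => by
    conv_rhs => rw [← hs i i]
    rw [sq]
    exact Finset.single_le_sum (f := fun j => P i j * P i j)
      (fun j _ => mul_self_nonneg _) (Finset.mem_univ i)
  have hD : ∑ i, P i i ^ 2 ≤ P.trace := Finset.sum_le_sum fun i _ => hdiag i
  have hD0 : 0 ≤ ∑ i, P i i ^ 2 := Finset.sum_nonneg fun i _ => sq_nonneg _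
  have hm4 : 0 ≤ ∫ x, x ^ 4 ∂μ := integral_nonneg fun x => by positivity
  have hcol : ∀ i, ∑ a, P a i ^ 2 = P i i := fun i => by
    rw [← hs i i]
    exact Finset.sum_congr rfl fun a _ => by
      rw [← congrFun (congrFun hT a) i, Matrix.transpose_apply, sq]
  have key : ∫ y, (y ⬝ᵥ P *ᵥ y) ^ 2 ∂(Measure.pi fun _ => μ) =
      (∫ x, x ^ 2 ∂μ) ^ 2 * (P.trace ^ 2 + 2 * P.trace) +
        ((∫ x, x ^ 4 ∂μ) - 3 * (∫ x, x ^ 2 ∂μ) ^ 2) * ∑ i, P i i ^ 2 := by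
    simp only [dotProduct_mulVec_proj hT hP, sq (∑ a, _), Finset.sum_mul_sum]
    rw [integral_finsetSum _ fun a _ => integrable_finsetSum _ fun b _ =>
      integrable_dotProduct_sq_mul_sq hpow (P a) (P b)]
    have : ∀ a, ∫ y, ∑ b, (P a ⬝ᵥ y) ^ 2 * (P b ⬝ᵥ y) ^ 2 ∂(Measure.pi fun _ => μ) =
        ∑ b, ((∫ x, x ^ 2 ∂μ) ^ 2 * (P a a * P b b + 2 * P a b ^ 2) +
        ((∫ x, x ^ 4 ∂μ) - 3 * (∫ x, x ^ 2 ∂μ) ^ 2) * ∑ i, P a i ^ 2 * P b i ^ 2) := by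
      intro a
      rw [integral_finsetSum _ fun b _ => integrable_dotProduct_sq_mul_sq hpow (P a) (P b)]
      refine Finset.sum_congr rfl fun b _ => ?_
      rw [integral_dotProduct_sq_mul_sq hpow h1 h3, hs]
      simp only [sq (P _ _), hs]
    rw [Finset.sum_congr rfl fun a _ => this a]
    have t1 : ∑ a, P a a * ∑ b, P b b = P.trace ^ 2 := by
      rw [sq, ← Finset.sum_mul]; rfl
    have t2 : ∑ a, ∑ b, P a b ^ 2 = P.trace :=
      Finset.sum_congr rfl fun a _ => by simp only [sq, hs]; rfl
    have t3 : ∑ a, ∑ b, ∑ i, P a i ^ 2 * P b i ^ 2 = ∑ i, P i i ^ 2 := by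
      calc ∑ a, ∑ b, ∑ i, P a i ^ 2 * P b i ^ 2 = ∑ a, ∑ i, P a i ^ 2 * P i i := by
            refine Finset.sum_congr rfl fun a _ => ?_
            rw [Finset.sum_comm]
            simp only [← Finset.mul_sum, hcol]
        _ = ∑ i, P i i ^ 2 := by
            rw [Finset.sum_comm]
            refine Finset.sum_congr rfl fun i _ => ?_
            rw [← Finset.sum_mul, hcol, sq]
    simp only [Finset.sum_add_distrib, ← Finset.mul_sum]
    rw [t1, t2, t3]
  rw [key]
  have hv : 0 ≤ (∫ x, x ^ 2 ∂μ) ^ 2 := sq_nonneg _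
  nlinarith [mul_nonneg hv hD0, mul_le_mul_of_nonneg_left hD hm4]

end ProductMoments

open Matrix in
lemma dotProduct_proj_nonneg {n : ℕ} {P : Matrix (Fin n) (Fin n) ℝ} (hT : Pᵀ = P)
    (hP : P * P = P) (y : Fin n → ℝ) : 0 ≤ y ⬝ᵥ P *ᵥ y := by
  have : y ⬝ᵥ P *ᵥ y = P *ᵥ y ⬝ᵥ P *ᵥ y := by
    conv_lhs => rw [← hP, ← mulVec_mulVec, dotProduct_mulVec, ← mulVec_transpose, hT]
  rw [this]
  exact Finset.sum_nonneg fun i _ => mul_self_nonneg _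

open scoped ENNReal in
lemma lintegral_sum_rpow_le_of_homogeneous {n d : ℕ} {q : ℝ} (hq : 0 < q)
    {f : (Fin n → ℝ) → ℝ≥0∞}
    (hom : ∀ r : ℝ, 0 < r → ∀ y, f (r • y) = ENNReal.ofReal r ^ d * f y) {s : ℝ} (hs : 0 < s) :
    ∫⁻ y in {y : Fin n → ℝ | ∑ i, |y i| ^ q ≤ s}, f y =
      ENNReal.ofReal (s ^ ((n + d : ℝ) / q)) *
        ∫⁻ y in {y : Fin n → ℝ | ∑ i, |y i| ^ q ≤ 1}, f y := by
  have hr : 0 < s ^ q⁻¹ := Real.rpow_pos_of_pos hs _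
  set r := s ^ q⁻¹ with hr_def
  have hrq : r ^ q = s := Real.rpow_inv_rpow hs.le hq.ne'
  have hmap : (volume : Measure (Fin n → ℝ)) =
      ENNReal.ofReal (r ^ n) • Measure.map (r • ·) volume := by
    rw [Measure.map_addHaar_smul volume hr.ne', smul_smul, Module.finrank_fin_fun,
      abs_of_pos (by positivity), ← ENNReal.ofReal_mul (by positivity),
      mul_inv_cancel₀ (by positivity), ENNReal.ofReal_one, one_smul]
  have hpre : (r • · : (Fin n → ℝ) → Fin n → ℝ) ⁻¹' {y | ∑ i, |y i| ^ q ≤ s} =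
      {y | ∑ i, |y i| ^ q ≤ 1} := by
    ext y
    simp only [Set.mem_preimage, Set.mem_ofPred_eq, Pi.smul_apply, smul_eq_mul, abs_mul,
      abs_of_pos hr, Real.mul_rpow hr.le (abs_nonneg _), hrq, ← Finset.mul_sum]
    exact mul_le_iff_le_one_right hs
  have hemb : MeasurableEmbedding (r • · : (Fin n → ℝ) → Fin n → ℝ) :=
    (Homeomorph.smulOfNeZero r hr.ne').measurableEmbedding
  conv_lhs => rw [hmap, Measure.restrict_smul, lintegral_smul_measure, hemb.restrict_map,
    hemb.lintegral_map, hpre]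
  simp_rw [hom r hr]
  rw [lintegral_const_mul' _ _ (by finiteness), smul_eq_mul, ← mul_assoc,
    ← ENNReal.ofReal_pow hr.le, ← ENNReal.ofReal_mul (by positivity), ← pow_add, hr_def,
    ← Real.rpow_natCast, ← Real.rpow_mul hs.le]
  congr 3
  push_cast
  ring

open scoped ENNReal in
lemma lintegral_mul_exp_neg_sum_rpow {n d : ℕ} {q : ℝ} (hq : 0 < q)
    {f : (Fin n → ℝ) → ℝ≥0∞} (hf : Measurable f)
    (hom : ∀ r : ℝ, 0 < r → ∀ y, f (r • y) = ENNReal.ofReal r ^ d * f y) :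
    ∫⁻ y, f y * ENNReal.ofReal (Real.exp (-∑ i, |y i| ^ q)) =
      ENNReal.ofReal (Real.Gamma (1 + (n + d) / q)) *
        ∫⁻ y in {y : Fin n → ℝ | ∑ i, |y i| ^ q ≤ 1}, f y := by
  have hball : ∀ c : ℝ, MeasurableSet {y : Fin n → ℝ | ∑ i, |y i| ^ q ≤ c} := fun c =>
    measurableSet_le (by fun_prop) measurable_const
  have layer (y : Fin n → ℝ) : ENNReal.ofReal (Real.exp (-∑ i, |y i| ^ q)) =
      ∫⁻ s in Set.Ioi 0, (Set.Ici (∑ i, |y i| ^ q)).indicator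
        (fun s : ℝ => ENNReal.ofReal (Real.exp (-s))) s := by
    have h0 : 0 ≤ ∑ i, |y i| ^ q := by positivity
    rw [lintegral_indicator measurableSet_Ici, Measure.restrict_restrict measurableSet_Ici,
      ← integral_exp_neg_Ioi, ofReal_integral_eq_lintegral_ofReal (integrableOn_exp_neg_Ioi _)
        (Eventually.of_forall fun s => (Real.exp_pos _).le)]
    refine setLIntegral_congr ?_
    have hinter : Set.Ioi (∑ i, |y i| ^ q) ∩ Set.Ioi 0 = Set.Ioi (∑ i, |y i| ^ q) :=
      Set.inter_eq_left.mpr (Set.Ioi_subset_Ioi h0)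
    have hae := (Ioi_ae_eq_Ici (μ := volume) (a := ∑ i, |y i| ^ q)).inter
      (ae_eq_refl (Set.Ioi (0 : ℝ)))
    rwa [hinter] at hae
  have hmeas : Measurable fun p : (Fin n → ℝ) × ℝ => f p.1 *
      (Set.Ici (∑ i, |p.1 i| ^ q)).indicator (fun s : ℝ => ENNReal.ofReal (Real.exp (-s))) p.2 := by
    refine (hf.comp measurable_fst).mul ?_
    have : (fun p : (Fin n → ℝ) × ℝ => (Set.Ici (∑ i, |p.1 i| ^ q)).indicator
        (fun s : ℝ => ENNReal.ofReal (Real.exp (-s))) p.2) =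
        {p : (Fin n → ℝ) × ℝ | ∑ i, |p.1 i| ^ q ≤ p.2}.indicator
          fun p => ENNReal.ofReal (Real.exp (-p.2)) := by
      ext p
      simp [Set.indicator_apply]
    rw [this]
    exact Measurable.indicator (by fun_prop) (measurableSet_le (by fun_prop) measurable_snd)
  simp_rw [layer]
  have hin (y : Fin n → ℝ) : Measurable fun s : ℝ =>
      (Set.Ici (∑ i, |y i| ^ q)).indicator (fun s : ℝ => ENNReal.ofReal (Real.exp (-s))) s :=
    Measurable.indicator (by fun_prop) measurableSet_Ici
  simp_rw [← lintegral_const_mul _ (hin _)]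
  rw [lintegral_lintegral_swap hmeas.aemeasurable]
  have slice : ∀ s ∈ Set.Ioi (0 : ℝ), ∫⁻ y : Fin n → ℝ, f y *
      (Set.Ici (∑ i, |y i| ^ q)).indicator (fun s : ℝ => ENNReal.ofReal (Real.exp (-s))) s =
      ENNReal.ofReal (Real.exp (-s) * s ^ (1 + (n + d : ℝ) / q - 1)) *
        ∫⁻ y in {y : Fin n → ℝ | ∑ i, |y i| ^ q ≤ 1}, f y := by
    intro s hs
    have hs : 0 < s := hs
    rw [ENNReal.ofReal_mul (Real.exp_pos _).le, mul_assoc, add_sub_cancel_left,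
      ← lintegral_sum_rpow_le_of_homogeneous hq hom hs, ← lintegral_const_mul _ hf,
      ← lintegral_indicator (hball s)]
    refine lintegral_congr fun y => ?_
    by_cases h : ∑ i, |y i| ^ q ≤ s <;> simp [h, mul_comm]
  rw [setLIntegral_congr_fun measurableSet_Ioi slice, lintegral_mul_const _ (by fun_prop),
    Real.Gamma_eq_integral (by positivity), ofReal_integral_eq_lintegral_ofReal
      (Real.GammaIntegral_convergent (by positivity))]
  exact (ae_restrict_iff' measurableSet_Ioi).mpr <| Eventually.of_forall fun s hs =>
    mul_nonneg (Real.exp_pos _).le (Real.rpow_nonneg (le_of_lt hs) _)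

open scoped ENNReal in
lemma lintegral_pi_prod_eq_prod_lintegral {n : ℕ} {f : Fin n → ℝ → ℝ≥0∞}
    (hf : ∀ i, Measurable (f i)) :
    ∫⁻ y : Fin n → ℝ, ∏ i, f i (y i) = ∏ i, ∫⁻ x, f i x := by
  induction n with
  | zero => simp [volume_pi]
  | succ n ih =>
    have mp := (volume_preserving_piFinSuccAbove (fun _ : Fin (n + 1) => ℝ) 0).symm
    rw [← mp.lintegral_comp_emb (MeasurableEquiv.measurableEmbedding _), Fin.prod_univ_succ,
      ← ih fun i => hf i.succ, ← lintegral_prod_mul (hf 0).aemeasurable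
        (Finset.measurable_prod _ fun i _ => (hf i.succ).comp (measurable_pi_apply i)).aemeasurable]
    refine lintegral_congr fun p => ?_
    simp [Fin.prod_univ_succ, MeasurableEquiv.piFinSuccAbove]

open scoped ENNReal in
lemma pi_withDensity_eq {n : ℕ} {f : ℝ → ℝ≥0∞} (hf : Measurable f)
    [SigmaFinite (volume.withDensity f)] :
    Measure.pi (fun _ : Fin n => volume.withDensity f) =
      volume.withDensity fun y : Fin n → ℝ => ∏ i, f (y i) := by
  refine Measure.pi_eq fun s hs => ?_
  rw [withDensity_apply _ (MeasurableSet.univ_pi hs),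
    ← lintegral_indicator (MeasurableSet.univ_pi hs)]
  simp only [withDensity_apply f (hs _), ← lintegral_indicator (hs _)]
  rw [← lintegral_pi_prod_eq_prod_lintegral fun i => hf.indicator (hs i)]
  refine lintegral_congr fun y => ?_
  by_cases h : y ∈ Set.univ.pi s
  · simp only [Set.indicator_of_mem h]
    exact Finset.prod_congr rfl fun i _ => by rw [Set.indicator_of_mem (h i trivial)]
  · rw [Set.indicator_of_notMem h]
    simp only [Set.mem_pi, Set.mem_univ, true_imp_iff, not_forall] at h
    obtain ⟨i, hi⟩ := h
    exact (Finset.prod_eq_zero (Finset.mem_univ i) (Set.indicator_of_notMem hi f)).symm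

/-- The probability measure on `ℝ` with density proportional to `exp (-|x| ^ q)`. -/
noncomputable def expPowMeasure (q : ℝ) : Measure ℝ :=
  volume.withDensity fun x => ENNReal.ofReal (Real.exp (-|x| ^ q) / (2 * Real.Gamma (1 / q + 1)))

section ExpPow

variable {q : ℝ}

lemma integrable_pow_mul_exp_neg_abs_rpow (hq : 0 < q) (k : ℕ) :
    Integrable fun x : ℝ => x ^ k * Real.exp (-|x| ^ q) := by
  have hpos : IntegrableOn (fun x : ℝ => x ^ k * Real.exp (-|x| ^ q)) (Set.Ioi 0) := by
    refine (integrableOn_rpow_mul_exp_neg_rpow (s := k) (p := q)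
      (by linarith [k.cast_nonneg (α := ℝ)]) hq).congr_fun (fun x hx => ?_) measurableSet_Ioi
    simp [abs_of_pos (show 0 < x from hx)]
  rw [← integrableOn_univ, ← Set.Iic_union_Ioi (a := (0 : ℝ)), integrableOn_union]
  refine ⟨?_, hpos⟩
  rw [← (Measure.measurePreserving_neg (volume : Measure ℝ)).integrableOn_comp_preimage
    (Homeomorph.neg ℝ).measurableEmbedding, integrableOn_congr_set_ae (t := Set.Ioi 0)]
  · refine IntegrableOn.congr_fun (hpos.const_mul ((-1 : ℝ) ^ k)) (fun x _ => ?_) measurableSet_Ioi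
    simp [neg_pow x k, mul_assoc]
  · simpa using Ioi_ae_eq_Ici.symm

lemma integral_abs_pow_mul_exp_neg_abs_rpow (hq : 0 < q) (k : ℕ) :
    ∫ x : ℝ, |x| ^ k * Real.exp (-|x| ^ q) = 2 / q * Real.Gamma ((k + 1) / q) := by
  rw [integral_comp_abs (f := fun x => x ^ k * Real.exp (-x ^ q))]
  have := integral_rpow_mul_exp_neg_rpow (p := q) (q := k) hq
    (by linarith [k.cast_nonneg (α := ℝ)])
  simp only [Real.rpow_natCast] at this
  rw [this]
  ring

lemma integrable_exp_neg_abs_rpow (hq : 0 < q) : Integrable fun x : ℝ => Real.exp (-|x| ^ q) := by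
  simpa using integrable_pow_mul_exp_neg_abs_rpow hq 0

lemma integral_exp_neg_abs_rpow (hq : 0 < q) :
    ∫ x : ℝ, Real.exp (-|x| ^ q) = 2 * Real.Gamma (1 / q + 1) := by
  have := integral_abs_pow_mul_exp_neg_abs_rpow hq 0
  rw [Real.Gamma_add_one (by positivity)]
  simp only [pow_zero, one_mul, Nat.cast_zero, zero_add] at this
  rw [this]
  ring

lemma isProbabilityMeasure_expPowMeasure (hq : 0 < q) :
    IsProbabilityMeasure (expPowMeasure q) := by
  refine ⟨?_⟩
  rw [expPowMeasure, withDensity_apply _ MeasurableSet.univ, Measure.restrict_univ,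
    ← ofReal_integral_eq_lintegral_ofReal ((integrable_exp_neg_abs_rpow hq).div_const _)
      (Eventually.of_forall fun x => by positivity), integral_div, integral_exp_neg_abs_rpow hq,
    div_self (by positivity), ENNReal.ofReal_one]

lemma integral_expPowMeasure (hq : 0 < q) (g : ℝ → ℝ) :
    ∫ x, g x ∂(expPowMeasure q) =
      (∫ x, g x * Real.exp (-|x| ^ q)) / (2 * Real.Gamma (1 / q + 1)) := by
  rw [expPowMeasure, integral_withDensity_eq_integral_toReal_smul (by fun_prop)
    (by simp), ← integral_div]
  refine integral_congr_ae <| Eventually.of_forall fun x => ?_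
  simp only [smul_eq_mul]
  rw [ENNReal.toReal_ofReal (by positivity)]
  ring

lemma integrable_pow_expPowMeasure (hq : 0 < q) (k : ℕ) :
    Integrable (fun x => x ^ k) (expPowMeasure q) := by
  rw [expPowMeasure, integrable_withDensity_iff (by fun_prop) (by simp)]
  refine ((integrable_pow_mul_exp_neg_abs_rpow hq k).div_const
    (2 * Real.Gamma (1 / q + 1))).congr <| Eventually.of_forall fun x => ?_
  simp only
  rw [ENNReal.toReal_ofReal (by positivity)]
  ring

lemma integral_odd_pow_expPowMeasure (hq : 0 < q) {k : ℕ} (hk : Odd k) :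
    ∫ x, x ^ k ∂(expPowMeasure q) = 0 := by
  have h := integral_neg_eq_self (fun x : ℝ => x ^ k * Real.exp (-|x| ^ q)) volume
  simp only [hk.neg_pow, abs_neg, neg_mul, integral_neg] at h
  rw [integral_expPowMeasure hq, div_eq_zero_iff]
  left
  linarith

lemma integral_sq_expPowMeasure (hq : 0 < q) :
    ∫ x, x ^ 2 ∂(expPowMeasure q) =
      Real.Gamma (1 + 3 * (1 / q)) / (3 * Real.Gamma (1 + 1 / q)) := by
  have h := integral_abs_pow_mul_exp_neg_abs_rpow hq 2
  simp only [sq_abs] at h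
  rw [integral_expPowMeasure hq, h, add_comm 1 (3 * (1 / q)),
    Real.Gamma_add_one (s := 3 * (1 / q)) (by positivity), add_comm 1 (1 / q)]
  have : ((2 : ℕ) + 1 : ℝ) / q = 3 * (1 / q) := by push_cast; ring
  rw [this]
  field_simp

end ExpPow

section UniformLq

variable {q : ℝ}

open scoped ENNReal in
lemma lintegral_pi_expPowMeasure_of_homogeneous (hq : 0 < q) {n d : ℕ} {f : (Fin n → ℝ) → ℝ≥0∞}
    (hf : Measurable f) (hom : ∀ r : ℝ, 0 < r → ∀ y, f (r • y) = ENNReal.ofReal r ^ d * f y) :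
    ∫⁻ y, f y ∂(Measure.pi fun _ => expPowMeasure q) =
      ENNReal.ofReal (Real.Gamma (1 + (n + d) / q) / (2 * Real.Gamma (1 / q + 1)) ^ n) *
        ∫⁻ y in {y : Fin n → ℝ | ∑ i, |y i| ^ q ≤ 1}, f y := by
  have := isProbabilityMeasure_expPowMeasure hq
  unfold expPowMeasure at this ⊢
  rw [pi_withDensity_eq (by fun_prop),
    lintegral_withDensity_eq_lintegral_mul _ (by fun_prop) hf,
    div_eq_inv_mul (Real.Gamma (1 + (n + d) / q)),
    ENNReal.ofReal_mul (by positivity), mul_assoc, ← lintegral_mul_exp_neg_sum_rpow hq hf hom,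
    ← lintegral_const_mul _ (by fun_prop)]
  refine lintegral_congr fun y => ?_
  rw [Pi.mul_apply, ← ENNReal.ofReal_prod_of_nonneg (fun i _ => by positivity),
    Finset.prod_div_distrib, Finset.prod_const, Finset.card_univ, Fintype.card_fin,
    ← Real.exp_sum, Finset.sum_neg_distrib, div_eq_inv_mul (Real.exp _), ENNReal.ofReal_mul (by positivity)]
  ring

lemma volume_sum_rpow_le_one (hq : 0 < q) (n : ℕ) :
    volume {y : Fin n → ℝ | ∑ i, |y i| ^ q ≤ 1} =
      ENNReal.ofReal ((2 * Real.Gamma (1 / q + 1)) ^ n / Real.Gamma (1 + n / q)) := by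
  have := isProbabilityMeasure_expPowMeasure hq
  have h := lintegral_pi_expPowMeasure_of_homogeneous hq (n := n) (d := 0) (f := fun _ => 1)
    measurable_const (by simp)
  simp only [Nat.cast_zero, add_zero, lintegral_const, measure_univ, mul_one,
    Measure.restrict_apply_univ, one_mul] at h
  rw [← inv_div, ENNReal.ofReal_inv_of_pos (by positivity)]
  exact ENNReal.eq_inv_of_mul_eq_one_left (by rw [mul_comm]; exact h.symm)

/-- The uniform probability measure on the `ℓ_q` unit ball, seen in `Fin n → ℝ`. -/
noncomputable def lqUnif (n : ℕ) (q : ℝ) : Measure (Fin n → ℝ) :=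
  (volume {y : Fin n → ℝ | ∑ i, |y i| ^ q ≤ 1})⁻¹ •
    volume.restrict {y : Fin n → ℝ | ∑ i, |y i| ^ q ≤ 1}

lemma isProbabilityMeasure_lqUnif (hq : 0 < q) (n : ℕ) :
    IsProbabilityMeasure (lqUnif n q) := by
  refine ⟨?_⟩
  rw [lqUnif, Measure.smul_apply, Measure.restrict_apply_univ, smul_eq_mul,
    volume_sum_rpow_le_one hq]
  refine ENNReal.inv_mul_cancel ?_ ENNReal.ofReal_ne_top
  rw [ne_eq, ENNReal.ofReal_eq_zero, not_le]
  positivity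

open scoped ENNReal in
lemma lintegral_lqUnif_of_homogeneous (hq : 0 < q) {n d : ℕ} {f : (Fin n → ℝ) → ℝ≥0∞}
    (hf : Measurable f) (hom : ∀ r : ℝ, 0 < r → ∀ y, f (r • y) = ENNReal.ofReal r ^ d * f y) :
    ∫⁻ y, f y ∂(lqUnif n q) =
      ENNReal.ofReal (Real.Gamma (1 + n / q) / Real.Gamma (1 + (n + d) / q)) *
        ∫⁻ y, f y ∂(Measure.pi fun _ => expPowMeasure q) := by
  rw [lqUnif, lintegral_smul_measure, volume_sum_rpow_le_one hq,
    lintegral_pi_expPowMeasure_of_homogeneous hq hf hom, ← mul_assoc,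
    ← ENNReal.ofReal_mul (by positivity), ← ENNReal.ofReal_inv_of_pos (by positivity), smul_eq_mul]
  congr 2
  field_simp

open Matrix in
lemma lintegral_lqUnif_proj (hq : 0 < q) {n : ℕ} {P : Matrix (Fin n) (Fin n) ℝ} (hT : Pᵀ = P)
    (hP : P * P = P) :
    ∫⁻ y, ENNReal.ofReal (y ⬝ᵥ P *ᵥ y) ∂(lqUnif n q) =
      ENNReal.ofReal (Real.Gamma (1 + n / q) / Real.Gamma (1 + (n + 2) / q) *
        ((∫ x, x ^ 2 ∂(expPowMeasure q)) * P.trace)) := by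
  have := isProbabilityMeasure_expPowMeasure hq
  have hpow := integrable_pow_expPowMeasure hq
  have h1 : ∫ x, x ∂(expPowMeasure q) = 0 := by
    simpa using integral_odd_pow_expPowMeasure hq odd_one
  have hm := lintegral_lqUnif_of_homogeneous hq (n := n) (d := 2)
    (f := fun y => ENNReal.ofReal (y ⬝ᵥ P *ᵥ y)) (by fun_prop) fun r hr y => by
      rw [← ENNReal.ofReal_pow hr.le, ← ENNReal.ofReal_mul (by positivity), mulVec_smul,
        smul_dotProduct, dotProduct_smul, smul_eq_mul, smul_eq_mul, ← mul_assoc, sq]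
  rw [hm, ENNReal.ofReal_mul (by positivity), ← integral_proj hpow h1 hT hP,
    ofReal_integral_eq_lintegral_ofReal (integrable_proj hpow hT hP)
      (Eventually.of_forall fun y => dotProduct_proj_nonneg hT hP y)]
  simp

open Matrix in
lemma lintegral_lqUnif_proj_sq_le (hq : 0 < q) {n : ℕ} {P : Matrix (Fin n) (Fin n) ℝ}
    (hT : Pᵀ = P) (hP : P * P = P) :
    ∫⁻ y, ENNReal.ofReal (y ⬝ᵥ P *ᵥ y) ^ 2 ∂(lqUnif n q) ≤
      ENNReal.ofReal (Real.Gamma (1 + n / q) / Real.Gamma (1 + (n + 4) / q) *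
        ((∫ x, x ^ 2 ∂(expPowMeasure q)) ^ 2 * (P.trace ^ 2 + 2 * P.trace) +
          (∫ x, x ^ 4 ∂(expPowMeasure q)) * P.trace)) := by
  have := isProbabilityMeasure_expPowMeasure hq
  have hpow := integrable_pow_expPowMeasure hq
  have h1 : ∫ x, x ∂(expPowMeasure q) = 0 := by
    simpa using integral_odd_pow_expPowMeasure hq odd_one
  have h3 : ∫ x, x ^ 3 ∂(expPowMeasure q) = 0 := integral_odd_pow_expPowMeasure hq (by decide)
  have hm := lintegral_lqUnif_of_homogeneous hq (n := n) (d := 4)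
    (f := fun y => ENNReal.ofReal (y ⬝ᵥ P *ᵥ y) ^ 2) (by fun_prop) fun r hr y => by
      rw [← ENNReal.ofReal_pow hr.le, mulVec_smul, smul_dotProduct, dotProduct_smul, smul_eq_mul,
        smul_eq_mul, ← mul_assoc, ENNReal.ofReal_mul (by positivity), mul_pow,
        ← ENNReal.ofReal_pow (by positivity)]
      congr 2
      ring
  rw [hm, ENNReal.ofReal_mul (by positivity)]
  gcongr
  · simp
  · refine le_trans (le_of_eq ?_)
      (ENNReal.ofReal_le_ofReal (integral_proj_sq_le hpow h1 h3 hT hP))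
    rw [ofReal_integral_eq_lintegral_ofReal (integrable_proj_sq hpow hT hP)
      (Eventually.of_forall fun y => sq_nonneg _)]
    exact lintegral_congr fun y => by
      rw [ENNReal.ofReal_pow (dotProduct_proj_nonneg hT hP y)]

end UniformLq

section GramMoments

open Matrix

lemma det_mul_transpose_nonneg {k n : ℕ} (X : Matrix (Fin k) (Fin n) ℝ) : 0 ≤ (X * Xᵀ).det := by
  simpa using (posSemidef_self_mul_conjTranspose X).det_nonneg

open scoped ENNReal in
lemma lintegral_pi_cons {α : Type*} [MeasurableSpace α] {k : ℕ} (ν : Measure α) [SigmaFinite ν]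
    {f : (Fin (k + 1) → α) → ℝ≥0∞} (hf : Measurable f) :
    ∫⁻ x, f x ∂(Measure.pi fun _ => ν) =
      ∫⁻ x, ∫⁻ y, f (Fin.cons y x) ∂ν ∂(Measure.pi fun _ : Fin k => ν) := by
  have mp := (measurePreserving_piFinSuccAbove (fun _ : Fin (k + 1) => ν) 0).symm
  rw [← mp.lintegral_comp hf, lintegral_prod_symm
    (fun p => f ((MeasurableEquiv.piFinSuccAbove (fun _ : Fin (k + 1) => α) 0).symm p))
    (hf.comp mp.measurable).aemeasurable]
  simp [MeasurableEquiv.piFinSuccAbove, Fin.consEquiv]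

lemma measurable_det_gram (k n : ℕ) :
    Measurable fun x : Fin k → Fin n → ℝ => (Matrix.of x * (Matrix.of x)ᵀ).det := by
  have h : Continuous fun x : Fin k → Fin n → ℝ => Matrix.of x := continuous_id
  exact (h.matrix_mul h.matrix_transpose).matrix_det.measurable

variable {q : ℝ}

lemma lintegral_det_gram_cons {n k : ℕ} (hq : 0 < q) (x : Fin k → Fin n → ℝ) :
    ∫⁻ y, ENNReal.ofReal
        (Matrix.of (Fin.cons y x) * (Matrix.of (Fin.cons y x))ᵀ).det ∂(lqUnif n q) =
      ENNReal.ofReal (Matrix.of x * (Matrix.of x)ᵀ).det *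
        ENNReal.ofReal (Real.Gamma (1 + n / q) / Real.Gamma (1 + (n + 2) / q) *
          ((∫ x, x ^ 2 ∂(expPowMeasure q)) * (n - k))) := by
  simp_rw [det_mul_transpose_cons, ENNReal.ofReal_mul (det_mul_transpose_nonneg _)]
  rw [lintegral_const_mul _ (by fun_prop)]
  by_cases h : (Matrix.of x * (Matrix.of x)ᵀ).det = 0
  · simp [h]
  · rw [lintegral_lqUnif_proj hq (complProj_transpose _) (complProj_mul_self h),
      trace_complProj h]

lemma lintegral_det_gram_cons_sq_le {n k : ℕ} (hq : 0 < q) (x : Fin k → Fin n → ℝ) :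
    ∫⁻ y, ENNReal.ofReal
        (Matrix.of (Fin.cons y x) * (Matrix.of (Fin.cons y x))ᵀ).det ^ 2 ∂(lqUnif n q) ≤
      ENNReal.ofReal (Matrix.of x * (Matrix.of x)ᵀ).det ^ 2 *
        ENNReal.ofReal (Real.Gamma (1 + n / q) / Real.Gamma (1 + (n + 4) / q) *
          ((∫ x, x ^ 2 ∂(expPowMeasure q)) ^ 2 * ((n - k) ^ 2 + 2 * (n - k)) +
            (∫ x, x ^ 4 ∂(expPowMeasure q)) * (n - k))) := by
  simp_rw [det_mul_transpose_cons, ENNReal.ofReal_mul (det_mul_transpose_nonneg _), mul_pow]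
  rw [lintegral_const_mul _ (by fun_prop)]
  by_cases h : (Matrix.of x * (Matrix.of x)ᵀ).det = 0
  · simp [h]
  · gcongr
    simpa only [trace_complProj h] using
      lintegral_lqUnif_proj_sq_le hq (complProj_transpose (Matrix.of x)) (complProj_mul_self h)

lemma lintegral_det_gram (hq : 0 < q) (n k : ℕ) :
    ∫⁻ x : Fin k → Fin n → ℝ, ENNReal.ofReal (Matrix.of x * (Matrix.of x)ᵀ).det
        ∂(Measure.pi fun _ => lqUnif n q) =
      ∏ j ∈ Finset.range k,
        ENNReal.ofReal (Real.Gamma (1 + n / q) / Real.Gamma (1 + (n + 2) / q) *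
          ((∫ x, x ^ 2 ∂(expPowMeasure q)) * (n - j))) := by
  have := isProbabilityMeasure_lqUnif hq n
  induction k with
  | zero => simp
  | succ k ih =>
    rw [lintegral_pi_cons _ (measurable_det_gram _ _).ennreal_ofReal]
    simp_rw [lintegral_det_gram_cons hq]
    rw [lintegral_mul_const _ (measurable_det_gram _ _).ennreal_ofReal, ih,
      Finset.prod_range_succ]

lemma lintegral_det_gram_sq_le (hq : 0 < q) (n k : ℕ) :
    ∫⁻ x : Fin k → Fin n → ℝ, ENNReal.ofReal (Matrix.of x * (Matrix.of x)ᵀ).det ^ 2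
        ∂(Measure.pi fun _ => lqUnif n q) ≤
      ∏ j ∈ Finset.range k,
        ENNReal.ofReal (Real.Gamma (1 + n / q) / Real.Gamma (1 + (n + 4) / q) *
          ((∫ x, x ^ 2 ∂(expPowMeasure q)) ^ 2 * ((n - j) ^ 2 + 2 * (n - j)) +
            (∫ x, x ^ 4 ∂(expPowMeasure q)) * (n - j))) := by
  have := isProbabilityMeasure_lqUnif hq n
  induction k with
  | zero => simp
  | succ k ih =>
    rw [lintegral_pi_cons _ ((measurable_det_gram _ _).ennreal_ofReal.pow_const 2)]
    refine (lintegral_mono fun x => lintegral_det_gram_cons_sq_le hq x).trans ?_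
    rw [lintegral_mul_const _ ((measurable_det_gram _ _).ennreal_ofReal.pow_const 2),
      Finset.prod_range_succ]
    gcongr

end GramMoments

section CrossPolytope

lemma convexHull_range_union_neg {ι E : Type*} [Fintype ι] [Nonempty ι] [AddCommGroup E]
    [Module ℝ E] (x : ι → E) :
    convexHull ℝ (Set.range x ∪ -Set.range x) =
      (fun c : ι → ℝ => ∑ i, c i • x i) '' {c | ∑ i, |c i| ≤ 1} := by
  classical
  refine Set.Subset.antisymm (convexHull_min ?_ ?_) ?_
  · rintro y (⟨i, rfl⟩ | ⟨i, hi⟩)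
    · refine ⟨Pi.single i 1, ?_, ?_⟩
      · simp [Pi.single_apply, apply_ite abs]
      · simp [Pi.single_apply]
    · refine ⟨Pi.single i (-1), ?_, ?_⟩
      · simp [Pi.single_apply, apply_ite abs]
      · simp [Pi.single_apply, hi]
  · have hc : Convex ℝ {c : ι → ℝ | ∑ i, |c i| ≤ 1} := by
      intro c hc d hd a b ha hb hab
      simp only [Set.mem_ofPred_eq] at hc hd ⊢
      calc ∑ i, |(a • c + b • d) i| ≤ ∑ i, (a * |c i| + b * |d i|) := by
            gcongr with i
            refine (abs_add_le _ _).trans_eq ?_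
            simp [abs_mul, abs_of_nonneg ha, abs_of_nonneg hb]
        _ = a * ∑ i, |c i| + b * ∑ i, |d i| := by
            rw [Finset.sum_add_distrib, Finset.mul_sum, Finset.mul_sum]
        _ ≤ a * 1 + b * 1 := by gcongr
        _ = 1 := by rw [mul_one, mul_one, hab]
    exact hc.linear_image (Fintype.linearCombination ℝ x)
  · rw [convexHull_union_neg_eq_absConvexHull]
    rintro _ ⟨c, hc, rfl⟩
    have hbal := balanced_absConvexHull (𝕜 := ℝ) (s := Set.range x)
    have hx : ∀ i, x i ∈ absConvexHull ℝ (Set.range x) := fun i =>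
      subset_absConvexHull ⟨i, rfl⟩
    have hs : 0 ≤ ∑ i, |c i| := Finset.sum_nonneg fun i _ => abs_nonneg _
    rcases hs.eq_or_lt with h0 | hpos
    · have hz : ∀ i, c i = 0 := fun i => abs_eq_zero.mp <|
        (Finset.sum_eq_zero_iff_of_nonneg fun i _ => abs_nonneg (c i)).mp h0.symm i
          (Finset.mem_univ i)
      simpa [hz] using hbal.zero_mem ⟨_, hx (Classical.arbitrary ι)⟩
    · have key := (convex_absConvexHull (𝕜 := ℝ) (s := Set.range x)).sum_mem
        (t := Finset.univ) (w := fun i => |c i| / ∑ j, |c j|)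
        (z := fun i => ((∑ j, |c j|) * SignType.sign (c i)) • x i)
        (fun i _ => by positivity) (by rw [← Finset.sum_div, div_self hpos.ne'])
        (fun i _ => hbal.smul_mem (by
          have : |((SignType.sign (c i) : SignType) : ℝ)| ≤ 1 := by
            cases SignType.sign (c i) <;> simp
          rw [Real.norm_eq_abs, abs_mul, abs_of_pos hpos]
          exact mul_le_one₀ hc (abs_nonneg _) this) (hx i))
      convert key using 2 with i
      rw [smul_smul]
      congr 1
      rw [div_mul_eq_mul_div, ← mul_assoc, mul_comm |c i|, mul_assoc, abs_mul_sign,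
        mul_div_cancel_left₀ _ hpos.ne']

lemma volume_convexHull_range_union_neg {n : ℕ} (hn : n ≠ 0)
    (x : Fin n → EuclideanSpace ℝ (Fin n)) :
    volume (convexHull ℝ (Set.range x ∪ -Set.range x)) =
      ENNReal.ofReal (|(Matrix.of fun i => (x i).ofLp).det| * (2 ^ n / n.factorial)) := by
  have : Nonempty (Fin n) := Fin.pos_iff_nonempty.mp (Nat.pos_of_ne_zero hn)
  have himg : convexHull ℝ (Set.range x ∪ -Set.range x) =
      WithLp.ofLp ⁻¹' (Matrix.toLin' (Matrix.of fun i => (x i).ofLp).transpose ''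
        {c : Fin n → ℝ | ∑ i, |c i| ≤ 1}) := by
    rw [convexHull_range_union_neg]
    ext y
    simp only [Set.mem_image, Set.mem_preimage]
    refine exists_congr fun c => and_congr_right fun _ => ?_
    rw [← (WithLp.ofLp_injective 2).eq_iff]
    refine Eq.congr_left ?_
    ext j
    simp [Matrix.mulVec, dotProduct, mul_comm]
  have hcross : volume {c : Fin n → ℝ | ∑ i, |c i| ≤ 1} =
      ENNReal.ofReal (2 ^ n / n.factorial) := by
    have h := volume_sum_rpow_le_one one_pos n
    simpa [add_comm (1 : ℝ), Real.Gamma_nat_eq_factorial, one_add_one_eq_two, Real.Gamma_two]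
      using h
  have hcomp : IsCompact {c : Fin n → ℝ | ∑ i, |c i| ≤ 1} := by
    refine Metric.isCompact_of_isClosed_isBounded
      (isClosed_le (by fun_prop) continuous_const) ?_
    refine (Metric.isBounded_closedBall (x := (0 : Fin n → ℝ)) (r := 1)).subset fun c hc => ?_
    rw [mem_closedBall_zero_iff, pi_norm_le_iff_of_nonneg zero_le_one]
    exact fun i => (Finset.single_le_sum (f := fun i => |c i|) (fun i _ => abs_nonneg _)
      (Finset.mem_univ i)).trans hc
  rw [himg, (PiLp.volume_preserving_ofLp (Fin n)).measure_preimage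
    ((hcomp.image (LinearMap.continuous_of_finiteDimensional _)).measurableSet.nullMeasurableSet),
    Measure.addHaar_image_linearMap, LinearMap.det_toLin', Matrix.det_transpose, hcross,
    ← ENNReal.ofReal_mul (abs_nonneg _)]

end CrossPolytope

section Moments

variable {q : ℝ}

lemma measurableSet_sum_rpow_le_one (n : ℕ) (q : ℝ) :
    MeasurableSet {y : Fin n → ℝ | ∑ i, |y i| ^ q ≤ 1} :=
  measurableSet_le (by fun_prop) measurable_const

lemma volume_lqBall_eq (n : ℕ) (q : ℝ) :
    volume (lqBall n q) = volume {y : Fin n → ℝ | ∑ i, |y i| ^ q ≤ 1} :=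
  (PiLp.volume_preserving_ofLp (Fin n)).measure_preimage
    (measurableSet_sum_rpow_le_one n q).nullMeasurableSet

lemma measurePreserving_ofLp_unifMeasure (n : ℕ) (q : ℝ) :
    MeasurePreserving WithLp.ofLp (unifMeasure n (lqBall n q)) (lqUnif n q) := by
  rw [unifMeasure, lqUnif, volume_lqBall_eq]
  exact ((PiLp.volume_preserving_ofLp (Fin n)).restrict_preimage
    (measurableSet_sum_rpow_le_one n q)).smul_measure _

lemma measurePreserving_ofLp_jointUnif (hq : 0 < q) (n : ℕ) :
    MeasurePreserving (fun (x : Fin n → EuclideanSpace ℝ (Fin n)) i => (x i).ofLp)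
      (jointUnif n n (lqBall n q)) (Measure.pi fun _ => lqUnif n q) := by
  have := isProbabilityMeasure_lqUnif hq n
  have : IsProbabilityMeasure (unifMeasure n (lqBall n q)) := by
    have mp := measurePreserving_ofLp_unifMeasure n q
    exact ⟨by rw [← Set.preimage_univ, mp.measure_preimage MeasurableSet.univ.nullMeasurableSet,
      measure_univ]⟩
  exact measurePreserving_pi _ _ fun _ => measurePreserving_ofLp_unifMeasure n q

/-- The ratio between the volume of the cross-polytope spanned by the rows of a matrix, normalized
by the volume of the `ℓ_q` unit ball, and the absolute value of the determinant. -/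
noncomputable def crossCoeff (n : ℕ) (q : ℝ) : ℝ :=
  2 ^ n / n.factorial * (Real.Gamma (1 + n / q) / (2 * Real.Gamma (1 / q + 1)) ^ n)

lemma randCrossVol_lqBall (hq : 0 < q) {n : ℕ} (hn : n ≠ 0)
    (x : Fin n → EuclideanSpace ℝ (Fin n)) :
    randCrossVol n (lqBall n q) x =
      crossCoeff n q * |(Matrix.of fun i => (x i).ofLp).det| := by
  rw [randCrossVol, volume_convexHull_range_union_neg hn, volume_lqBall_eq,
    volume_sum_rpow_le_one hq, ENNReal.toReal_ofReal (by positivity),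
    ENNReal.toReal_ofReal (by positivity), crossCoeff]
  field_simp

open Matrix in
lemma momentVlq_two_mul (hq : 0 < q) {n : ℕ} (hn : n ≠ 0) (k : ℕ) :
    momentVlq n q (2 * k) = crossCoeff n q ^ (2 * k) *
      ∫ x : Fin n → Fin n → ℝ, (Matrix.of x * (Matrix.of x)ᵀ).det ^ k
        ∂(Measure.pi fun _ => lqUnif n q) := by
  have mp := measurePreserving_ofLp_jointUnif hq n
  rw [momentVlq, ← integral_const_mul, ← mp.map_eq, integral_map mp.measurable.aemeasurable
    (by
      exact (((measurable_det_gram n n).pow_const k).const_mul _).aestronglyMeasurable)]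
  refine integral_congr_ae <| Eventually.of_forall fun x => ?_
  simp only [randCrossVol_lqBall hq hn, det_mul, det_transpose]
  rw [mul_pow, pow_mul |_|, sq_abs, sq]

open Matrix in
lemma integral_det_gram (hq : 0 < q) (n : ℕ) :
    ∫ x : Fin n → Fin n → ℝ, (Matrix.of x * (Matrix.of x)ᵀ).det
        ∂(Measure.pi fun _ => lqUnif n q) =
      ∏ j ∈ Finset.range n, (Real.Gamma (1 + n / q) / Real.Gamma (1 + (n + 2) / q) *
          ((∫ x, x ^ 2 ∂(expPowMeasure q)) * (n - j))) := by
  have hv : 0 ≤ ∫ x, x ^ 2 ∂(expPowMeasure q) := integral_nonneg fun x => sq_nonneg x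
  rw [integral_eq_lintegral_of_nonneg_ae (Eventually.of_forall fun x =>
    det_mul_transpose_nonneg (Matrix.of x)) (measurable_det_gram n n).aestronglyMeasurable,
    lintegral_det_gram hq, ENNReal.toReal_prod]
  refine Finset.prod_congr rfl fun j hj => ENNReal.toReal_ofReal ?_
  have : (j : ℝ) ≤ n := by exact_mod_cast (Finset.mem_range.mp hj).le
  have := sub_nonneg.mpr this
  positivity

open Matrix in
lemma integrable_det_gram_sq (hq : 0 < q) (n : ℕ) :
    Integrable (fun x : Fin n → Fin n → ℝ => (Matrix.of x * (Matrix.of x)ᵀ).det ^ 2)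
      (Measure.pi fun _ => lqUnif n q) := by
  refine ⟨((measurable_det_gram n n).pow_const 2).aestronglyMeasurable, ?_⟩
  rw [hasFiniteIntegral_iff_ofReal (Eventually.of_forall fun x => sq_nonneg _)]
  simp_rw [ENNReal.ofReal_pow (det_mul_transpose_nonneg _)]
  exact (lintegral_det_gram_sq_le hq n n).trans_lt
    (ENNReal.prod_lt_top fun _ _ => ENNReal.ofReal_lt_top)

open Matrix in
lemma integral_det_gram_sq_le (hq : 0 < q) (n : ℕ) :
    ∫ x : Fin n → Fin n → ℝ, (Matrix.of x * (Matrix.of x)ᵀ).det ^ 2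
        ∂(Measure.pi fun _ => lqUnif n q) ≤
      ∏ j ∈ Finset.range n, (Real.Gamma (1 + n / q) / Real.Gamma (1 + (n + 4) / q) *
          ((∫ x, x ^ 2 ∂(expPowMeasure q)) ^ 2 * ((n - j) ^ 2 + 2 * (n - j)) +
            (∫ x, x ^ 4 ∂(expPowMeasure q)) * (n - j))) := by
  have hv : 0 ≤ ∫ x, x ^ 2 ∂(expPowMeasure q) := integral_nonneg fun x => sq_nonneg x
  have hw : 0 ≤ ∫ x, x ^ 4 ∂(expPowMeasure q) := integral_nonneg fun x => by positivity
  have hnn : ∀ j ∈ Finset.range n, 0 ≤ Real.Gamma (1 + n / q) / Real.Gamma (1 + (n + 4) / q) *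
      ((∫ x, x ^ 2 ∂(expPowMeasure q)) ^ 2 * ((n - j) ^ 2 + 2 * (n - j)) +
        (∫ x, x ^ 4 ∂(expPowMeasure q)) * (n - j)) := fun j hj => by
    have : (j : ℝ) ≤ n := by exact_mod_cast (Finset.mem_range.mp hj).le
    have := sub_nonneg.mpr this
    positivity
  rw [integral_eq_lintegral_of_nonneg_ae (Eventually.of_forall fun x => sq_nonneg _)
    ((measurable_det_gram n n).pow_const 2).aestronglyMeasurable]
  refine ENNReal.toReal_le_of_le_ofReal (Finset.prod_nonneg hnn) ?_
  rw [ENNReal.ofReal_prod_of_nonneg hnn]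
  simp_rw [ENNReal.ofReal_pow (det_mul_transpose_nonneg _)]
  exact lintegral_det_gram_sq_le hq n n

open Matrix in
lemma sq_momentVlq_two_le (hq : 0 < q) {n : ℕ} (hn : n ≠ 0) :
    momentVlq n q 2 ^ 2 ≤ momentVlq n q 4 := by
  have := isProbabilityMeasure_lqUnif hq n
  have hL : MemLp (fun x : Fin n → Fin n → ℝ => (Matrix.of x * (Matrix.of x)ᵀ).det) 2
      (Measure.pi fun _ => lqUnif n q) :=
    (memLp_two_iff_integrable_sq (measurable_det_gram n n).aestronglyMeasurable).mpr
      (integrable_det_gram_sq hq n)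
  have h := ProbabilityTheory.variance_nonneg
    (fun x : Fin n → Fin n → ℝ => (Matrix.of x * (Matrix.of x)ᵀ).det)
    (Measure.pi fun _ => lqUnif n q)
  rw [ProbabilityTheory.variance_eq_sub hL, sub_nonneg] at h
  have h2 := momentVlq_two_mul hq hn 1
  have h4 := momentVlq_two_mul hq hn 2
  simp only [mul_one, pow_one, Nat.reduceMul] at h2 h4
  rw [h2, h4, mul_pow, ← pow_mul]
  exact mul_le_mul_of_nonneg_left h (Even.pow_nonneg (by decide) _)

end Moments

section Asymptotics

open Real

variable {q : ℝ}

lemma tendsto_log_gamma_nat_div (hq : 0 < q) :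
    Tendsto (fun n : ℕ => log (Gamma (1 + n / q)) / n - 1 / q * log (n / q)) atTop
      (nhds (-(1 / q))) := by
  simpa only [mul_one_div] using tendsto_log_Gamma_div (one_div_pos.mpr hq)

lemma tendsto_log_factorial_div :
    Tendsto (fun n : ℕ => log n.factorial / n - log n) atTop (nhds (-1)) := by
  simpa [add_comm (1 : ℝ), Gamma_nat_eq_factorial] using tendsto_log_Gamma_div one_pos

lemma tendsto_log_gamma_ratio (hq : 0 < q) {d : ℝ} (hd : 0 < d) :
    Tendsto (fun n : ℕ => log (Gamma (1 + n / q) / Gamma (1 + (n + d) / q)) +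
      d * (1 / q * log (n / q))) atTop (nhds 0) := by
  have h := ((tendsto_log_Gamma_add_sub (div_pos hd hq)).comp
    (tendsto_natCast_atTop_atTop.atTop_div_const hq)).neg
  rw [neg_zero] at h
  refine h.congr fun n => ?_
  rw [log_div (by positivity) (by positivity)]
  simp only [Function.comp_apply]
  rw [show 1 + (n : ℝ) / q + d / q = 1 + (n + d) / q by ring]
  ring

lemma mul_rpow_inv_eq_exp {n : ℕ} (hn : n ≠ 0) (k : ℕ) {M : ℝ} (hM : 0 < M) :
    (n : ℝ) ^ k * M ^ ((n : ℝ)⁻¹) = exp (log M / n + k * log n) := by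
  have : (0 : ℝ) < n := by positivity
  rw [exp_add, rpow_def_of_pos hM, mul_comm, ← div_eq_mul_inv, ← log_pow,
    exp_log (by positivity)]

lemma prod_range_natCast_sub (n : ℕ) :
    ∏ j ∈ Finset.range n, ((n : ℝ) - j) = n.factorial := by
  have h := Finset.prod_range_reflect (fun j => ((j : ℝ) + 1)) n
  rw [← Finset.prod_range_add_one_eq_factorial]
  push_cast
  rw [← h]
  refine Finset.prod_congr rfl fun j hj => ?_
  have : j + 1 ≤ n := Finset.mem_range.mp hj
  rw [Nat.sub_sub, Nat.cast_sub (by omega)]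
  push_cast
  ring

lemma prod_range_sq_add_le {C : ℝ} (hC : 0 ≤ C) (n : ℕ) :
    ∏ j ∈ Finset.range n, (((n : ℝ) - j) ^ 2 + C * (n - j)) ≤
      (n.factorial : ℝ) ^ 2 * exp (C * (1 + log n)) := by
  have hreflect : ∏ j ∈ Finset.range n, (((n : ℝ) - j) ^ 2 + C * (n - j)) =
      ∏ j ∈ Finset.range n, (((j : ℝ) + 1) ^ 2 + C * (j + 1)) := by
    rw [← Finset.prod_range_reflect]
    refine Finset.prod_congr rfl fun j hj => ?_
    have : j + 1 ≤ n := Finset.mem_range.mp hj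
    rw [Nat.sub_sub, Nat.cast_sub (by omega)]
    push_cast
    ring
  have hharm : ∑ j ∈ Finset.range n, ((j : ℝ) + 1)⁻¹ ≤ 1 + log n := by
    have := harmonic_le_one_add_log n
    rw [harmonic] at this
    push_cast at this
    exact this
  calc _ = ∏ j ∈ Finset.range n, (((j : ℝ) + 1) ^ 2 + C * (j + 1)) := hreflect
    _ ≤ ∏ j ∈ Finset.range n, (((j : ℝ) + 1) ^ 2 * exp (C * ((j : ℝ) + 1)⁻¹)) := by
        refine Finset.prod_le_prod (fun j _ => by positivity) fun j _ => ?_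
        have : (0 : ℝ) < (j : ℝ) + 1 := by positivity
        calc ((j : ℝ) + 1) ^ 2 + C * (j + 1)
            = ((j : ℝ) + 1) ^ 2 * (C * ((j : ℝ) + 1)⁻¹ + 1) := by field_simp; ring
          _ ≤ _ := by gcongr; exact add_one_le_exp _
    _ = (n.factorial : ℝ) ^ 2 * exp (C * ∑ j ∈ Finset.range n, ((j : ℝ) + 1)⁻¹) := by
        rw [Finset.prod_mul_distrib, Finset.prod_pow, ← exp_sum, ← Finset.mul_sum,
          ← Finset.prod_range_add_one_eq_factorial]
        push_cast
        rfl
    _ ≤ _ := by gcongr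

lemma integral_sq_expPowMeasure_pos (hq : 0 < q) : 0 < ∫ x, x ^ 2 ∂(expPowMeasure q) := by
  rw [integral_sq_expPowMeasure hq]
  positivity

lemma crossCoeff_pos (hq : 0 < q) (n : ℕ) : 0 < crossCoeff n q := by
  unfold crossCoeff
  positivity

lemma log_crossCoeff_div (hq : 0 < q) {n : ℕ} (hn : n ≠ 0) :
    log (crossCoeff n q) / n = log 2 - log (2 * Gamma (1 / q + 1)) - log n.factorial / n +
      log (Gamma (1 + n / q)) / n := by
  have : (0 : ℝ) < n := by positivity
  have : (0 : ℝ) < n.factorial := by positivity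
  rw [crossCoeff, log_mul (by positivity) (by positivity), log_div (by positivity) (by positivity),
    log_div (by positivity) (by positivity), log_pow, log_pow]
  field_simp
  ring

lemma momentVlq_two_eq (hq : 0 < q) {n : ℕ} (hn : n ≠ 0) :
    momentVlq n q 2 = crossCoeff n q ^ 2 *
      ((Gamma (1 + n / q) / Gamma (1 + (n + 2) / q) * ∫ x, x ^ 2 ∂(expPowMeasure q)) ^ n *
        n.factorial) := by
  have h := momentVlq_two_mul hq hn 1
  simp only [mul_one, pow_one] at h
  rw [h, integral_det_gram hq]
  simp_rw [← mul_assoc]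
  rw [Finset.prod_mul_distrib, prod_range_natCast_sub, Finset.prod_const, Finset.card_range,
    mul_assoc]

lemma exists_momentVlq_four_le (hq : 0 < q) : ∃ C : ℝ, ∀ n : ℕ, n ≠ 0 →
    momentVlq n q 4 ≤ crossCoeff n q ^ 4 *
      ((Gamma (1 + n / q) / Gamma (1 + (n + 4) / q) *
        (∫ x, x ^ 2 ∂(expPowMeasure q)) ^ 2) ^ n *
        ((n.factorial : ℝ) ^ 2 * exp (C * (1 + log n)))) := by
  have hv := integral_sq_expPowMeasure_pos hq
  have hw : 0 ≤ ∫ x, x ^ 4 ∂(expPowMeasure q) := integral_nonneg fun x => by positivity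
  set v := ∫ x, x ^ 2 ∂(expPowMeasure q)
  set w := ∫ x, x ^ 4 ∂(expPowMeasure q)
  refine ⟨2 + w / v ^ 2, fun n hn => ?_⟩
  have h := momentVlq_two_mul hq hn 2
  simp only [Nat.reduceMul] at h
  have hc := crossCoeff_pos hq n
  rw [h]
  gcongr
  refine (integral_det_gram_sq_le hq n).trans ?_
  calc _ = ∏ j ∈ Finset.range n, (Gamma (1 + n / q) / Gamma (1 + (n + 4) / q) * v ^ 2 *
        (((n : ℝ) - j) ^ 2 + (2 + w / v ^ 2) * (n - j))) := by
        refine Finset.prod_congr rfl fun j _ => ?_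
        rw [mul_assoc]
        congr 1
        field_simp
        ring
    _ ≤ _ := by
        rw [Finset.prod_mul_distrib, Finset.prod_const, Finset.card_range]
        gcongr
        exact prod_range_sq_add_le (by positivity) n

lemma alphaFn_eq_exp (hq : 0 < q) :
    alphaFn (1 / q) = exp (2 * (log 2 - log (2 * Gamma (1 / q + 1))) +
      log (∫ x, x ^ 2 ∂(expPowMeasure q)) + 1 - 2 * (1 / q)) := by
  have hv := integral_sq_expPowMeasure_pos hq
  have h2 : (2 : ℝ) * (log 2 - log (2 * Gamma (1 / q + 1))) =
      log ((2 / (2 * Gamma (1 / q + 1))) ^ 2) := by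
    rw [log_pow, log_div (by positivity) (by positivity)]
    norm_num
  have h3 : Gamma (1 / q + 1) ≠ 0 := by positivity
  rw [add_sub_assoc, exp_add, exp_add, h2, exp_log (by positivity), exp_log hv,
    integral_sq_expPowMeasure hq, alphaFn, add_comm 1 (1 / q)]
  set A := Gamma (1 / q + 1)
  field_simp

lemma tendsto_mul_momentVlq_two (hq : 0 < q) :
    Tendsto (fun n : ℕ => (n : ℝ) * momentVlq n q 2 ^ ((n : ℝ)⁻¹)) atTop
      (nhds (alphaFn (1 / q))) := by
  have hv := integral_sq_expPowMeasure_pos hq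
  rw [alphaFn_eq_exp hq]
  set v := ∫ x, x ^ 2 ∂(expPowMeasure q)
  have hlim := (((tendsto_log_gamma_nat_div hq).const_mul 2).sub tendsto_log_factorial_div).add
    ((tendsto_log_gamma_ratio hq two_pos).add_const
      (2 * (log 2 - log (2 * Gamma (1 / q + 1))) + log v))
  rw [show 2 * (log 2 - log (2 * Gamma (1 / q + 1))) + log v + 1 - 2 * (1 / q) =
    2 * -(1 / q) - -1 + (0 + (2 * (log 2 - log (2 * Gamma (1 / q + 1))) + log v)) by ring]
  refine ((continuous_exp.tendsto _).comp hlim).congr' ?_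
  filter_upwards [eventually_ne_atTop 0] with n hn
  have hc := crossCoeff_pos hq n
  have hn' : (0 : ℝ) < n := by positivity
  have hf : (0 : ℝ) < n.factorial := by positivity
  have hM := momentVlq_two_eq hq hn
  have h := mul_rpow_inv_eq_exp hn 1 (M := momentVlq n q 2) (by rw [hM]; positivity)
  have hlog : log (momentVlq n q 2) / n = 2 * (log (crossCoeff n q) / n) +
      (log (Gamma (1 + n / q) / Gamma (1 + (n + 2) / q)) + log v) + log n.factorial / n := by
    rw [hM, log_mul (by positivity) (by positivity), log_mul (by positivity) (by positivity),
      log_pow, log_pow, log_mul (by positivity) hv.ne']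
    field_simp
    push_cast
    ring
  rw [pow_one] at h
  rw [Function.comp_apply, h, hlog, log_crossCoeff_div hq hn]
  congr 1
  push_cast
  ring

lemma tendsto_sq_mul_momentVlq_four (hq : 0 < q) :
    Tendsto (fun n : ℕ => (n : ℝ) ^ 2 * momentVlq n q 4 ^ ((n : ℝ)⁻¹)) atTop
      (nhds (alphaFn (1 / q) ^ 2)) := by
  have hv := integral_sq_expPowMeasure_pos hq
  obtain ⟨C, hC⟩ := exists_momentVlq_four_le hq
  have hα := alphaFn_eq_exp hq
  set v := ∫ x, x ^ 2 ∂(expPowMeasure q)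
  have hlog : Tendsto (fun n : ℕ => C * (1 / (n : ℝ) + log n / n)) atTop (nhds 0) := by
    have h : Tendsto (fun n : ℕ => log (n : ℝ) / n) atTop (nhds 0) := by
      exact isLittleO_log_id_atTop.tendsto_div_nhds_zero.comp tendsto_natCast_atTop_atTop
    simpa using ((tendsto_one_div_atTop_nhds_zero_nat (𝕜 := ℝ)).add h).const_mul C
  have hlim := ((((tendsto_log_gamma_nat_div hq).const_mul 4).sub
    (tendsto_log_factorial_div.const_mul 2)).add
    ((tendsto_log_gamma_ratio hq four_pos).add_const
      (4 * (log 2 - log (2 * Gamma (1 / q + 1))) + 2 * log v))).add hlog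
  have hupper := (continuous_exp.tendsto _).comp hlim
  rw [show 4 * -(1 / q) - 2 * -1 + (0 + (4 * (log 2 - log (2 * Gamma (1 / q + 1))) +
    2 * log v)) + 0 = 2 * (2 * (log 2 - log (2 * Gamma (1 / q + 1))) + log v + 1 - 2 * (1 / q))
    by ring, two_mul (2 * _ + _ + _ - _), exp_add, ← hα, ← sq] at hupper
  refine tendsto_of_tendsto_of_tendsto_of_le_of_le' ((tendsto_mul_momentVlq_two hq).pow 2)
    hupper ?_ ?_
  · filter_upwards [eventually_ne_atTop 0] with n hn
    have hc := crossCoeff_pos hq n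
    have hM : 0 ≤ momentVlq n q 2 := by rw [momentVlq_two_eq hq hn]; positivity
    rw [mul_pow, ← rpow_natCast (momentVlq n q 2 ^ _), ← rpow_mul hM, mul_comm (_ : ℝ)⁻¹,
      rpow_mul hM, rpow_natCast]
    gcongr
    exact sq_momentVlq_two_le hq hn
  · filter_upwards [eventually_ne_atTop 0] with n hn
    have hc := crossCoeff_pos hq n
    have hn' : (0 : ℝ) < n := by positivity
    have hf : (0 : ℝ) < n.factorial := by positivity
    have hM : 0 ≤ momentVlq n q 4 := (sq_nonneg _).trans (sq_momentVlq_two_le hq hn)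
    refine (mul_le_mul_of_nonneg_left (rpow_le_rpow hM (hC n hn) (by positivity))
      (by positivity)).trans_eq ?_
    have hlogU : log (crossCoeff n q ^ 4 * ((Gamma (1 + n / q) / Gamma (1 + (n + 4) / q) *
        v ^ 2) ^ n * ((n.factorial : ℝ) ^ 2 * exp (C * (1 + log n))))) / n =
        4 * (log (crossCoeff n q) / n) +
        (log (Gamma (1 + n / q) / Gamma (1 + (n + 4) / q)) + 2 * log v) +
        2 * (log n.factorial / n) + C * (1 / n + log n / n) := by
      rw [log_mul (by positivity) (by positivity), log_mul (by positivity) (by positivity),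
        log_mul (by positivity) (by positivity), log_exp, log_pow, log_pow, log_pow,
        log_mul (by positivity) (by positivity), log_pow]
      field_simp
      push_cast
      ring
    rw [mul_rpow_inv_eq_exp hn 2 (by positivity), Function.comp_apply, hlogU,
      log_crossCoeff_div hq hn]
    congr 1
    push_cast
    ring

end Asymptotics

/-- For fixed `1 ≤ q < ∞`, `n (𝔼 V_{B_qⁿ}²)^{1/n} → α(1/q)` and
`n² (𝔼 V_{B_qⁿ}⁴)^{1/n} → α(1/q)²` as `n → ∞`. -/
theorem asymptotics_moments_randCrossVol_lqBall (q : ℝ) (hq : 1 ≤ q) :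
    Tendsto (fun n : ℕ => (n : ℝ) * momentVlq n q 2 ^ ((n : ℝ)⁻¹)) atTop
        (nhds (alphaFn (1 / q))) ∧
      Tendsto (fun n : ℕ => (n : ℝ) ^ 2 * momentVlq n q 4 ^ ((n : ℝ)⁻¹)) atTop
        (nhds (alphaFn (1 / q) ^ 2)) :=
  ⟨tendsto_mul_momentVlq_two (by positivity), tendsto_sq_mul_momentVlq_four (by positivity)⟩
end

section
/- Let Tₙ be the set of triples (τ₁, τ₂, τ₃) of permutations of {1, …, n} such that for each j = 1, …, n, at least one of τ₁(j), τ₂(j), τ₃(j) equals j and the other two are equal to each other. Then for every (τ₁, τ₂, τ₃) ∈ Tₙ, the sign of the composite permutation τ₁τ₂τ₃ equals 1. -/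
/-- If `(τ₁, τ₂, τ₃)` is a triple of permutations of `{1, …, n}` such that for every `j`,
at least one of `τ₁ j, τ₂ j, τ₃ j` equals `j` and the other two are equal to each other,
then `sgn(τ₁ τ₂ τ₃) = 1`. -/
theorem sign_of_triple_eq_one (n : ℕ) (τ₁ τ₂ τ₃ : Equiv.Perm (Fin n))
    (h : ∀ j : Fin n,
      (τ₁ j = j ∧ τ₂ j = τ₃ j) ∨ (τ₂ j = j ∧ τ₁ j = τ₃ j) ∨ (τ₃ j = j ∧ τ₁ j = τ₂ j)) :
    Equiv.Perm.sign (τ₁ * τ₂ * τ₃) = 1 := by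
  have i₁ : ∀ a b, τ₁ a = τ₁ b → a = b := fun _ _ e => τ₁.injective e
  have i₂ : ∀ a b, τ₂ a = τ₂ b → a = b := fun _ _ e => τ₂.injective e
  have i₃ : ∀ a b, τ₃ a = τ₃ b → a = b := fun _ _ e => τ₃.injective e
  -- The points moved by both `τ₁` and `τ₂` form an invariant set, on which `τ₁ = τ₂`.
  let p : Fin n → Prop := fun j => τ₁ j ≠ j ∧ τ₂ j ≠ j
  have hp : ∀ j, p (τ₁ j) ↔ p j := by
    intro j
    have h₁ := i₁ (τ₁ j) j
    have h₂ := i₂ (τ₁ j) j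
    have h₃ := i₃ (τ₁ j) j
    have hj := h j
    have hk := h (τ₁ j)
    simp only [p]
    grind
  let ρ : Equiv.Perm (Fin n) := Equiv.Perm.ofSubtype (τ₁.subtypePerm hp)
  have ρ_in : ∀ j, p j → ρ j = τ₁ j := fun j hj =>
    Equiv.Perm.ofSubtype_apply_of_mem (τ₁.subtypePerm hp) hj
  have ρ_out : ∀ j, ¬ p j → ρ j = j := fun j hj =>
    Equiv.Perm.ofSubtype_apply_of_not_mem (τ₁.subtypePerm hp) hj
  have key : τ₁ * τ₂ = τ₃ * (ρ * ρ) := by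
    ext1 j
    simp only [Equiv.Perm.mul_apply]
    by_cases hj : p j
    · have hj₁ := (hp j).2 hj
      have hj₂ := (hp _).2 hj₁
      rw [ρ_in j hj, ρ_in _ hj₁]
      have e := h j
      have e₂ := h (τ₁ (τ₁ j))
      simp only [p] at hj hj₂
      grind
    · rw [ρ_out j hj, ρ_out j hj]
      have e := h j
      have e₂ := h (τ₂ j)
      have h₂ := i₂ (τ₂ j) j
      have h₃ := i₃ (τ₂ j) j
      simp only [p] at hj
      grind
  rw [key, Equiv.Perm.sign_mul, Equiv.Perm.sign_mul, Equiv.Perm.sign_mul,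
    Int.units_mul_self, mul_one, Int.units_mul_self]
end

section
/- Let dₙ (for n ≥ 1) be the number of triples (τ₁, τ₂, τ₃) of permutations of {1, …, n} such that for each j = 1, …, n, at least one of τ₁(j), τ₂(j), τ₃(j) equals j, the other two are equal to each other, and not all three equal j; set d₀ = 1. Then for each n ≥ 1, d_{n+1} = n (dₙ + 3 d_{n−1}). -/
/-- The number `dₙ` of triples `(τ₁, τ₂, τ₃)` of permutations of `{1, …, n}` such that for
each `j`, at least one of `τ₁ j, τ₂ j, τ₃ j` equals `j`, the other two are equal to each
other, and not all three equal `j`.  (For `n = 0` this number is `1`, matching the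
convention `d₀ = 1`.) -/
noncomputable def dTriples (n : ℕ) : ℕ :=
  Nat.card {t : Equiv.Perm (Fin n) × Equiv.Perm (Fin n) × Equiv.Perm (Fin n) //
    ∀ j : Fin n,
      ((t.1 j = j ∧ t.2.1 j = t.2.2 j) ∨ (t.2.1 j = j ∧ t.1 j = t.2.2 j) ∨
          (t.2.2 j = j ∧ t.1 j = t.2.1 j)) ∧
        ¬(t.1 j = j ∧ t.2.1 j = j ∧ t.2.2 j = j)}

/-- Permutations `σ` of `α` with fixed-point set exactly `s`, together with a coloring of `α`
by `κ` that is constant on the cycles of `σ`. -/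
abbrev ColoredPerm (κ α : Type*) (s : Set α) : Type _ :=
  {p : (α → κ) × Equiv.Perm α //
    (∀ x, p.1 (p.2 x) = p.1 x) ∧ ∀ x, p.2 x = x ↔ x ∈ s}

namespace ColoredPerm

variable {κ α β : Type*}

/-- Transport of colored permutations along an equivalence. -/
def congr (e : α ≃ β) (t : Set β) : ColoredPerm κ α (e ⁻¹' t) ≃ ColoredPerm κ β t :=
  (Equiv.prodCongr (Equiv.arrowCongr e (Equiv.refl κ)) e.permCongr).subtypeEquiv (by
    rintro ⟨c, σ⟩
    refine and_congr ?_ ?_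
    · rw [← e.forall_congr_right]
      simp [Equiv.permCongr_apply]
    · rw [← e.forall_congr_right (q := fun y => _ ↔ y ∈ t)]
      simp [Equiv.permCongr_apply])

/-- A colored permutation of `Option β` fixing only `none` is a color for `none` together with
a colored derangement of `β`. -/
theorem card_option_singleton (κ β : Type*) :
    Nat.card (ColoredPerm κ (Option β) {none}) = Nat.card κ * Nat.card (ColoredPerm κ β ∅) := by
  rw [← Nat.card_prod]
  symm
  refine Nat.card_eq_of_bijective (fun q : κ × ColoredPerm κ β ∅ =>
    (⟨(fun o => o.elim q.1 q.2.1.1, Equiv.optionCongr q.2.1.2), ?_, ?_⟩ :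
      ColoredPerm κ (Option β) {none})) ⟨?_, ?_⟩
  · rintro (_ | x)
    · simp
    · simpa using q.2.2.1 x
  · rintro (_ | x)
    · simp
    · simpa using q.2.2.2 x
  · rintro ⟨k, ⟨c, σ⟩, h⟩ ⟨k', ⟨c', σ'⟩, h'⟩ he
    simp only [Subtype.mk.injEq, Prod.mk.injEq, Equiv.optionCongr_injective.eq_iff] at he
    obtain ⟨hc, rfl⟩ := he
    have h₁ : k = k' := congrFun hc none
    have h₂ : c = c' := funext fun x => congrFun hc (some x)
    subst h₁ h₂
    rfl
  · rintro ⟨⟨c, π⟩, hinv, hfix⟩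
    have hnone : π none = none := (hfix none).2 rfl
    have hsome (x) : some (Equiv.removeNone π x) = π (some x) := by
      refine Equiv.removeNone_some π (Option.ne_none_iff_exists'.1 fun h => ?_)
      exact Option.some_ne_none x (π.injective (h.trans hnone.symm))
    refine ⟨⟨c none, ⟨(fun x => c (some x), Equiv.removeNone π), fun x => ?_, fun x => ?_⟩⟩, ?_⟩
    · simpa only [hsome] using hinv (some x)
    · have := hfix (some x)
      rw [← hsome] at this
      simpa using this
    · refine Subtype.ext (Prod.ext (funext ?_) (Equiv.ext ?_))
      · rintro (_ | x) <;> rfl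
      · rintro (_ | x)
        · simp [hnone]
        · simp [hsome]

theorem decomposeOption_symm_some [DecidableEq α] (a : α) (σ : Equiv.Perm α) (x : α) :
    Equiv.Perm.decomposeOption.symm (some a, σ) (some x) =
      if σ x = a then none else some (σ x) := by
  split_ifs with h
  · simp [h]
  · simpa using Equiv.swap_apply_of_ne_of_ne (Option.some_ne_none _) (by simpa using h)

/-- Removing `none` from a colored derangement of `Option α` leaves its image `a` under the
derangement together with a colored permutation having no fixed point except possibly `a`. -/
theorem card_option_empty_eq_sigma (κ α : Type*) :
    Nat.card (ColoredPerm κ (Option α) ∅) =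
      Nat.card (Σ a : α, {p : (α → κ) × Equiv.Perm α //
        (∀ x, p.1 (p.2 x) = p.1 x) ∧ ∀ x, p.2 x = x → x = a}) := by
  classical
  symm
  refine Nat.card_eq_of_bijective (fun q =>
    (⟨(fun o => o.elim (q.2.1.1 q.1) q.2.1.1,
      Equiv.Perm.decomposeOption.symm (some q.1, q.2.1.2)), ?_, ?_⟩ :
        ColoredPerm κ (Option α) ∅)) ⟨?_, ?_⟩
  · obtain ⟨a, ⟨c, σ⟩, hinv, hfix⟩ := q
    rintro (_ | x)
    · simp
    · rw [decomposeOption_symm_some]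
      dsimp only at hinv ⊢
      have := hinv x
      split_ifs with h
      · simpa [h] using this
      · simpa using this
  · obtain ⟨a, ⟨c, σ⟩, hinv, hfix⟩ := q
    rintro (_ | x)
    · simp
    · rw [decomposeOption_symm_some]
      have := hfix x
      dsimp only at this ⊢
      split_ifs with h
      · simp
      · simp only [Option.some.injEq, Set.mem_empty_iff_false, iff_false]
        intro hx
        exact h (hx.trans (this hx))
  · rintro ⟨a, ⟨c, σ⟩, h⟩ ⟨a', ⟨c', σ'⟩, h'⟩ he
    simp only [Subtype.mk.injEq, Prod.mk.injEq, Equiv.apply_eq_iff_eq, Option.some.injEq] at he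
    obtain ⟨hc, rfl, rfl⟩ := he
    have h₂ : c = c' := funext fun x => congrFun hc (some x)
    subst h₂
    rfl
  · rintro ⟨⟨c, π⟩, hinv, hfix⟩
    obtain ⟨⟨_ | a, σ⟩, rfl⟩ := Equiv.Perm.decomposeOption.symm.surjective π
    · exact absurd ((hfix none).1 (by simp)) (Set.notMem_empty _)
    have ha : c (some a) = c none := by simpa using hinv none
    refine ⟨⟨a, ⟨(fun x => c (some x), σ), fun x => ?_, fun x hx => ?_⟩⟩, ?_⟩
    · have := hinv (some x)
      rw [decomposeOption_symm_some] at this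
      dsimp only at this ⊢
      split_ifs at this with h
      · rw [h, ha, this]
      · exact this
    · by_contra hxa
      refine (hfix (some x)).1 ?_
      dsimp only at hx ⊢
      rw [decomposeOption_symm_some, if_neg (by rwa [hx]), hx]
    · refine Subtype.ext (Prod.ext (funext ?_) rfl)
      rintro (_ | x)
      · exact ha
      · rfl

theorem card_fixed_subset_singleton (κ : Type*) {α : Type*} [Finite κ] [Finite α] (a : α) :
    Nat.card {p : (α → κ) × Equiv.Perm α //
        (∀ x, p.1 (p.2 x) = p.1 x) ∧ ∀ x, p.2 x = x → x = a} =
      Nat.card (ColoredPerm κ α ∅) + Nat.card (ColoredPerm κ α {a}) := by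
  classical
  rw [← Nat.card_sum, ← Nat.card_congr (subtypeOrEquiv _ _ ?_)]
  · refine Nat.card_congr (Equiv.subtypeEquivRight fun p => ?_)
    rw [← and_or_left]
    refine and_congr_right fun _ => ?_
    simp only [Set.mem_empty_iff_false, iff_false, Set.mem_singleton_iff]
    by_cases h : p.2 a = a
    · refine ⟨fun H => Or.inr fun x => ⟨H x, fun hx => hx ▸ h⟩, ?_⟩
      rintro (H | H) x hx
      · exact absurd hx (H x)
      · exact (H x).1 hx
    · refine ⟨fun H => Or.inl fun x hx => h (H x hx ▸ hx), ?_⟩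
      rintro (H | H) x hx
      · exact absurd hx (H x)
      · exact (H x).1 hx
  · rw [Pi.disjoint_iff]
    intro p
    simp only [Prop.disjoint_iff]
    rintro ⟨⟨-, h⟩, -, h'⟩
    exact (h a).1 ((h' a).2 rfl)

theorem card_fin_singleton (κ : Type*) (m : ℕ) (a : Fin (m + 1)) :
    Nat.card (ColoredPerm κ (Fin (m + 1)) {a}) =
      Nat.card κ * Nat.card (ColoredPerm κ (Fin m) ∅) := by
  rw [← card_option_singleton, ← Nat.card_congr (congr (finSuccEquiv' a) {none})]
  have : finSuccEquiv' a ⁻¹' {none} = {a} := by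
    ext x
    rw [Set.mem_preimage, Set.mem_singleton_iff, Set.mem_singleton_iff,
      ← (finSuccEquiv' a).eq_symm_apply, finSuccEquiv'_symm_none]
  rw [this]

theorem card_fin_add_two (κ : Type*) [Finite κ] (m : ℕ) :
    Nat.card (ColoredPerm κ (Fin (m + 2)) ∅) =
      (m + 1) * (Nat.card (ColoredPerm κ (Fin (m + 1)) ∅) +
        Nat.card κ * Nat.card (ColoredPerm κ (Fin m) ∅)) := by
  have h := Nat.card_congr (congr (κ := κ) (finSuccEquiv (m + 1)) ∅)
  rw [Set.preimage_empty] at h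
  rw [h, card_option_empty_eq_sigma, Nat.card_sigma]
  simp [card_fixed_subset_singleton, card_fin_singleton]

/-- The permutation acting as `σ` off the color class of `k` and fixing that class. -/
def fixColor [DecidableEq κ] (c : α → κ) (σ : Equiv.Perm α) (h : ∀ x, c (σ x) = c x) (k : κ) :
    Equiv.Perm α where
  toFun x := if c x = k then x else σ x
  invFun x := if c x = k then x else σ.symm x
  left_inv x := by
    dsimp only
    split_ifs with h₁ h₂ <;> simp_all
  right_inv x := by
    have := h (σ.symm x)
    rw [Equiv.apply_symm_apply] at this
    dsimp only
    split_ifs with h₁ h₂ <;> simp_all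

@[simp]
theorem fixColor_apply [DecidableEq κ] (c : α → κ) (σ : Equiv.Perm α) (h : ∀ x, c (σ x) = c x)
    (k : κ) (x : α) : fixColor c σ h k x = if c x = k then x else σ x :=
  rfl

end ColoredPerm

open ColoredPerm in
theorem dTriples_eq_card_coloredPerm (n : ℕ) :
    dTriples n = Nat.card (ColoredPerm (Fin 3) (Fin n) ∅) := by
  symm
  refine Nat.card_eq_of_bijective (fun q =>
    ⟨(fixColor q.1.1 q.1.2 q.2.1 0, fixColor q.1.1 q.1.2 q.2.1 1,
      fixColor q.1.1 q.1.2 q.2.1 2), fun j => ?_⟩) ⟨?_, ?_⟩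
  · obtain ⟨⟨c, σ⟩, hinv, hfix⟩ := q
    have hj : σ j ≠ j := fun h => (hfix j).1 h
    have hc : ∀ k : Fin 3, k = 0 ∨ k = 1 ∨ k = 2 := by decide
    rcases hc (c j) with h | h | h <;> simp [h, hj]
  · rintro ⟨⟨c, σ⟩, hinv, hfix⟩ ⟨⟨c', σ'⟩, hinv', hfix'⟩ he
    simp only [Subtype.mk.injEq, Prod.mk.injEq, Equiv.ext_iff, fixColor_apply] at he
    obtain ⟨h₀, h₁, h₂⟩ := he
    have key (j) : c j = c' j ∧ σ j = σ' j := by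
      have hj : σ j ≠ j := fun h => (hfix j).1 h
      have hj' : σ' j ≠ j := fun h => (hfix' j).1 h
      have hc : ∀ k : Fin 3, k = 0 ∨ k = 1 ∨ k = 2 := by decide
      have e₀ := h₀ j
      have e₁ := h₁ j
      have e₂ := h₂ j
      rcases hc (c j) with h | h | h <;> rcases hc (c' j) with h' | h' | h' <;>
        grind
    refine Subtype.ext (Prod.ext (funext fun j => (key j).1) (Equiv.ext fun j => (key j).2))
  · rintro ⟨⟨τ₁, τ₂, τ₃⟩, h⟩
    dsimp only at h
    have i₁ := fun x y => τ₁.injective.eq_iff (a := x) (b := y)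
    have i₂ := fun x y => τ₂.injective.eq_iff (a := x) (b := y)
    have i₃ := fun x y => τ₃.injective.eq_iff (a := x) (b := y)
    let c (j : Fin n) : Fin 3 := if τ₁ j = j then 0 else if τ₂ j = j then 1 else 2
    let f (j : Fin n) : Fin n := if τ₁ j = j then τ₂ j else τ₁ j
    have hcf (j) : c (f j) = c j := by
      have := h j
      have := h (f j)
      grind
    have hf : Function.Injective f := by
      intro j k hjk
      have := hcf j
      have := hcf k
      have := h j
      have := h k
      grind
    refine ⟨⟨(c, Equiv.ofBijective f (Finite.injective_iff_bijective.1 hf)), hcf, fun j => ?_⟩, ?_⟩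
    · have := h j
      simp only [Equiv.ofBijective_apply, Set.mem_empty_iff_false, iff_false]
      grind
    · refine Subtype.ext (Prod.ext (Equiv.ext fun j => ?_)
        (Prod.ext (Equiv.ext fun j => ?_) (Equiv.ext fun j => ?_))) <;>
      · have := h j
        simp only [fixColor_apply, Equiv.ofBijective_apply]
        grind

/-- The recurrence `d_{n+1} = n (dₙ + 3 d_{n−1})` for `n ≥ 1`. -/
theorem dTriples_recurrence (n : ℕ) (hn : 1 ≤ n) :
    dTriples (n + 1) = n * (dTriples n + 3 * dTriples (n - 1)) := by
  obtain ⟨m, rfl⟩ := Nat.exists_eq_add_of_le' hn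
  simp only [dTriples_eq_card_coloredPerm, Nat.add_sub_cancel]
  simpa using ColoredPerm.card_fin_add_two (Fin 3) m
end
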